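/- arXiv:0901.2453 — 7 statements merged into one kernel-verified Lean document; each statement's English description precedes it below -/
import Mathlib

section
/- Assume there exist a non-decreasing function r : ℕ → (0,∞) with r(k) → ∞ as k → ∞, measurable functions W, V : X → [1,∞) and a constant C₀ < ∞ such that (a) for all k ∈ ℕ and all x, x' ∈ X, r(k)·‖P^k(x,·) − P^k(x',·)‖_W ≤ C₀ (V(x) + V(x')), and (b) there exists x₀ ∈ X with sup_{k≥0} P^k W(x₀) < ∞. Let β ∈ (0,1) and let n : X → ℕ satisfy n(x) ≥ r⁻¹((C₀/β)·V(x)/W(x)) for all x, where r⁻¹(t) := inf{k ∈ ℕ : r(k) ≥ t}. Then there exists b < ∞ such that P^{n(x)} W(x) ≤ β W(x) + b for all x ∈ X; moreover, for any β' with β < β' < 1, setting C := {x ∈ X : W(x) ≤ b/(β'−β)}, one has P^{n(x)} W(x) ≤ β' W(x) + b·1_C(x) for all x ∈ X. -/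
open MeasureTheory ProbabilityTheory ENNReal Set Filter

variable {X : Type*} [MeasurableSpace X]

/-- The `n`-step transition kernel `P^n`. -/
noncomputable def kernelIter (P : Kernel X X) : ℕ → Kernel X X
  | 0 => Kernel.id
  | n + 1 => (kernelIter P n) ∘ₖ P

instance kernelIter.instIsMarkovKernel (P : Kernel X X) [IsMarkovKernel P] (n : ℕ) :
    IsMarkovKernel (kernelIter P n) := by
  induction n with
  | zero => rw [kernelIter]; infer_instance
  | succ n ih => rw [kernelIter]; exact Kernel.IsMarkovKernel.comp _ _

/-- `P^n f (x) = ∫ P^n(x, dy) f(y)` for a nonnegative (real-valued) function `f`. -/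
noncomputable def kernelExp (μ : Measure X) (f : X → ℝ) : ℝ≥0∞ :=
  ∫⁻ y, ENNReal.ofReal (f y) ∂μ

/-- The `f`-norm `‖μ - ν‖_f = ∫ f d|μ - ν|` of the difference of two finite measures. -/
noncomputable def fNorm (μ ν : Measure X) [IsFiniteMeasure μ] [IsFiniteMeasure ν]
    (f : X → ℝ) : ℝ≥0∞ :=
  ∫⁻ x, ENNReal.ofReal (f x) ∂((μ.toSignedMeasure - ν.toSignedMeasure).totalVariation)

/-- `retTaboo P C f n x = 𝔼ₓ[f(Φₙ) 1_{Φ₁ ∉ C, …, Φₙ ∉ C}] = 𝔼ₓ[f(Φₙ) 1_{τ_C > n}]`,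
where `τ_C` is the first return time to `C`. -/
noncomputable def retTaboo (P : Kernel X X) (C : Set X) (f : X → ℝ≥0∞) : ℕ → X → ℝ≥0∞
  | 0 => f
  | n + 1 => fun x => ∫⁻ y, Cᶜ.indicator (retTaboo P C f n) y ∂(P x)

/-- `survival P C n x = ℙₓ(τ_C > n)` where `τ_C := inf {n ≥ 1 : Φₙ ∈ C}`. -/
noncomputable def survival (P : Kernel X X) (C : Set X) (n : ℕ) (x : X) : ℝ≥0∞ :=
  retTaboo P C (fun _ => 1) n x

/-- `𝔼ₓ[R(τ_C)]` for `R : ℕ → ℝ≥0∞`, where `τ_C := inf {n ≥ 1 : Φₙ ∈ C}` is the first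
return time to `C`, with the convention `R(∞) = lim_n R(n) = ⨆ n, R(n+1)`
(the event `{τ_C = ∞}` has probability `⨅ n, ℙₓ(τ_C > n)`). -/
noncomputable def expReturn (P : Kernel X X) (C : Set X) (R : ℕ → ℝ≥0∞) (x : X) : ℝ≥0∞ :=
  (∑' n, R (n + 1) * (survival P C n x - survival P C (n + 1) x))
    + (⨆ n, R (n + 1)) * ⨅ n, survival P C n x

/-- `hitTaboo P C f n x = 𝔼ₓ[f(Φₙ) 1_{Φ₀ ∉ C, …, Φ_{n-1} ∉ C}] = 𝔼ₓ[f(Φₙ) 1_{σ_C ≥ n}]`,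
where `σ_C := inf {n ≥ 0 : Φₙ ∈ C}` is the hitting time of `C`. -/
noncomputable def hitTaboo (P : Kernel X X) (C : Set X) (f : X → ℝ≥0∞) : ℕ → X → ℝ≥0∞
  | 0 => f
  | n + 1 => fun x => Cᶜ.indicator (fun x' => ∫⁻ y, hitTaboo P C f n y ∂(P x')) x

/-- `hitSurvival P C n x = ℙₓ(σ_C ≥ n)` where `σ_C := inf {n ≥ 0 : Φₙ ∈ C}`. -/
noncomputable def hitSurvival (P : Kernel X X) (C : Set X) (n : ℕ) (x : X) : ℝ≥0∞ :=
  hitTaboo P C (fun _ => 1) n x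

/-- A set `C` is small for the kernel `P`: `P(x, ·) ≥ ε ν(·)` for all `x ∈ C`,
for some `ε > 0` and nontrivial measure `ν`. -/
def IsSmallSet (P : Kernel X X) (C : Set X) : Prop :=
  ∃ (ε : ℝ) (ν : Measure X), 0 < ε ∧ ν ≠ 0 ∧
    ∀ x ∈ C, ∀ A : Set X, MeasurableSet A → ENNReal.ofReal ε * ν A ≤ P x A

/-- `P` is phi-irreducible. -/
def KIrreducible (P : Kernel X X) : Prop :=
  ∃ φ : Measure X, φ ≠ 0 ∧ SigmaFinite φ ∧
    ∀ A : Set X, MeasurableSet A → 0 < φ A → ∀ x : X, ∃ n, 1 ≤ n ∧ 0 < kernelIter P n x A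

/-- `P` is aperiodic: there is a small set `C₀` with small-set measure `ν`, `ν C₀ > 0`, such
that the set `{n ≥ 1 : ∃ δ > 0, ∀ x ∈ C₀, P^n(x,·) ≥ δ ν(·)}` has gcd `1` (i.e. every common
divisor of this set equals `1`). -/
def KAperiodic (P : Kernel X X) : Prop :=
  ∃ (C₀ : Set X) (ν : Measure X) (ε : ℝ), MeasurableSet C₀ ∧ 0 < ε ∧ ν ≠ 0 ∧
    (∀ x ∈ C₀, ∀ A : Set X, MeasurableSet A → ENNReal.ofReal ε * ν A ≤ P x A) ∧
    0 < ν C₀ ∧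
    ∀ d : ℕ,
      (∀ n, 1 ≤ n →
        (∃ δ : ℝ, 0 < δ ∧ ∀ x ∈ C₀, ∀ A : Set X, MeasurableSet A →
            ENNReal.ofReal δ * ν A ≤ kernelIter P n x A) → d ∣ n) → d = 1

/-- A set `D` is accessible for `P`. -/
def Accessible (P : Kernel X X) (D : Set X) : Prop :=
  ∀ x : X, ∃ n, 1 ≤ n ∧ 0 < kernelIter P n x D

/-- The class `Λ` of subgeometric rate sequences. -/
def SubgeometricRate (r : ℕ → ℝ) : Prop :=
  (∀ n, 0 ≤ r n) ∧ Monotone r ∧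
    ∃ r₀ : ℕ → ℝ, 1 ≤ r₀ 0 ∧ Monotone r₀ ∧
      (∀ m n : ℕ, 1 ≤ m → m ≤ n → Real.log (r₀ n) / n ≤ Real.log (r₀ m) / m) ∧
      Tendsto (fun n => Real.log (r₀ n) / n) atTop (nhds 0) ∧
      Tendsto (fun n => r n / r₀ n) atTop (nhds 1)

/-- A finite measure is dominated by another one plus the total variation of their difference. -/
theorem measure_le_add_totalVariation_sub (μ ν : Measure X) [IsFiniteMeasure μ]
    [IsFiniteMeasure ν] :
    μ ≤ ν + (μ.toSignedMeasure - ν.toSignedMeasure).totalVariation := by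
  set s := μ.toSignedMeasure - ν.toSignedMeasure with hs
  have hdec : s.toJordanDecomposition.toSignedMeasure = s :=
    s.toSignedMeasure_toJordanDecomposition
  refine Measure.le_iff.2 fun A hA => ?_
  have hpos : μ.real A - ν.real A ≤ s.toJordanDecomposition.posPart.real A := by
    have hsA : s A = μ.real A - ν.real A := by
      rw [hs, sub_apply, Measure.toSignedMeasure_apply_measurable hA,
        Measure.toSignedMeasure_apply_measurable hA]
    have hJ : s A = s.toJordanDecomposition.posPart.real A
        - s.toJordanDecomposition.negPart.real A := by
      conv_lhs => rw [← hdec]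
      rw [JordanDecomposition.toSignedMeasure, sub_apply,
        Measure.toSignedMeasure_apply_measurable hA, Measure.toSignedMeasure_apply_measurable hA]
    linarith [measureReal_nonneg (μ := s.toJordanDecomposition.negPart) (s := A)]
  calc μ A = ENNReal.ofReal (μ.real A) := (ofReal_measureReal).symm
    _ ≤ ENNReal.ofReal (ν.real A + s.toJordanDecomposition.posPart.real A) :=
      ENNReal.ofReal_le_ofReal (by linarith)
    _ = ν A + s.toJordanDecomposition.posPart A := by
      rw [ENNReal.ofReal_add measureReal_nonneg measureReal_nonneg, ofReal_measureReal,
        ofReal_measureReal]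
    _ ≤ (ν + s.totalVariation) A := by
      rw [Measure.add_apply, SignedMeasure.totalVariation, Measure.add_apply]
      gcongr
      exact le_self_add

theorem kernelExp_le_add_fNorm (μ ν : Measure X) [IsFiniteMeasure μ] [IsFiniteMeasure ν]
    (f : X → ℝ) : kernelExp μ f ≤ kernelExp ν f + fNorm μ ν f := by
  rw [kernelExp, kernelExp, fNorm, ← lintegral_add_measure]
  exact lintegral_mono' (measure_le_add_totalVariation_sub μ ν) le_rfl

/-- Theorem `Ergo2Subsample`.  If the differences of the iterates of `P`
converge in `W`-norm at rate `r` (controlled by `V`), and `P^k W (x₀)` is uniformly bounded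
for some `x₀`, then subsampling `P` at a rate `n(x) ≥ r⁻¹((C₀/β) V(x)/W(x))` yields a
geometric Foster-Lyapunov drift condition. -/
theorem statement0
    (P : Kernel X X) [IsMarkovKernel P]
    (r : ℕ → ℝ) (hr_pos : ∀ k, 0 < r k) (hr_mono : Monotone r)
    (hr_top : Tendsto r atTop atTop)
    (W V : X → ℝ) (hWmeas : Measurable W) (hVmeas : Measurable V)
    (hW1 : ∀ x, 1 ≤ W x) (hV1 : ∀ x, 1 ≤ V x)
    (C₀ : ℝ) (hC₀ : 0 ≤ C₀)
    (hnorm : ∀ (k : ℕ) (x x' : X),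
      ENNReal.ofReal (r k) * fNorm ((kernelIter P k) x) ((kernelIter P k) x') W
        ≤ ENNReal.ofReal (C₀ * (V x + V x')))
    (x₀ : X) (hx₀ : (⨆ k, kernelExp ((kernelIter P k) x₀) W) < ⊤)
    (β : ℝ) (hβ : β ∈ Set.Ioo (0 : ℝ) 1)
    (n : X → ℕ)
    (hn : ∀ x, sInf {k : ℕ | C₀ / β * (V x / W x) ≤ r k} ≤ n x) :
    ∃ b : ℝ, 0 ≤ b ∧
      (∀ x, kernelExp ((kernelIter P (n x)) x) W ≤ ENNReal.ofReal (β * W x + b)) ∧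
      ∀ β' : ℝ, β < β' → β' < 1 →
        ∀ x, kernelExp ((kernelIter P (n x)) x) W ≤
          ENNReal.ofReal (β' * W x +
            b * Set.indicator {y : X | W y ≤ b / (β' - β)} (fun _ => 1) x) := by
  obtain ⟨hβ0, -⟩ := hβ
  set M := ⨆ k, kernelExp ((kernelIter P k) x₀) W
  have hV0 : 0 ≤ V x₀ := zero_le_one.trans (hV1 x₀)
  have hc : 0 ≤ C₀ * V x₀ / r 0 := div_nonneg (mul_nonneg hC₀ hV0) (hr_pos 0).le
  set b := M.toReal + C₀ * V x₀ / r 0 with hb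
  have hb0 : 0 ≤ b := add_nonneg ENNReal.toReal_nonneg hc
  have hrate : ∀ x, C₀ / β * (V x / W x) ≤ r (n x) := by
    intro x
    have hmem : C₀ / β * (V x / W x) ≤ r (sInf {k : ℕ | C₀ / β * (V x / W x) ≤ r k}) :=
      Nat.sInf_mem (hr_top.eventually_ge_atTop (C₀ / β * (V x / W x))).exists
    exact hmem.trans (hr_mono (hn x))
  have hdrift : ∀ x, kernelExp ((kernelIter P (n x)) x) W ≤ ENNReal.ofReal (β * W x + b) := by
    intro x
    have hW0 : 0 < W x := zero_lt_one.trans_le (hW1 x)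
    have hr := hr_pos (n x)
    have hVx : C₀ * V x / r (n x) ≤ β * W x := by
      rw [div_le_iff₀ hr]
      calc C₀ * V x = β * W x * (C₀ / β * (V x / W x)) := by field_simp
        _ ≤ β * W x * r (n x) := mul_le_mul_of_nonneg_left (hrate x) (by positivity)
    have hVx₀ : C₀ * V x₀ / r (n x) ≤ C₀ * V x₀ / r 0 :=
      div_le_div_of_nonneg_left (mul_nonneg hC₀ hV0) (hr_pos 0) (hr_mono (Nat.zero_le _))
    have hf : fNorm ((kernelIter P (n x)) x) ((kernelIter P (n x)) x₀) W
        ≤ ENNReal.ofReal (β * W x + C₀ * V x₀ / r 0) := by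
      calc _ ≤ ENNReal.ofReal (C₀ * (V x + V x₀)) / ENNReal.ofReal (r (n x)) := by
            rw [ENNReal.le_div_iff_mul_le (.inl (ENNReal.ofReal_pos.2 hr).ne')
              (.inl ENNReal.ofReal_ne_top), mul_comm]
            exact hnorm _ _ _
        _ = ENNReal.ofReal (C₀ * (V x + V x₀) / r (n x)) := (ENNReal.ofReal_div_of_pos hr).symm
        _ ≤ _ := ENNReal.ofReal_le_ofReal (by rw [mul_add, add_div]; exact add_le_add hVx hVx₀)
    calc _ ≤ _ := kernelExp_le_add_fNorm _ ((kernelIter P (n x)) x₀) W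
      _ ≤ M + ENNReal.ofReal (β * W x + C₀ * V x₀ / r 0) :=
        add_le_add (le_iSup (fun k => kernelExp ((kernelIter P k) x₀) W) (n x)) hf
      _ = ENNReal.ofReal (β * W x + b) := by
        rw [← ENNReal.ofReal_toReal hx₀.ne, ← ENNReal.ofReal_add ENNReal.toReal_nonneg
          (by positivity)]
        congr 1
        rw [hb]
        ring
  refine ⟨b, hb0, hdrift, fun β' hββ' _ x => (hdrift x).trans (ENNReal.ofReal_le_ofReal ?_)⟩
  have hW0 : 0 < W x := zero_lt_one.trans_le (hW1 x)
  by_cases hx : x ∈ {y : X | W y ≤ b / (β' - β)}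
  · rw [Set.indicator_of_mem hx]
    nlinarith
  · rw [Set.indicator_of_notMem hx]
    rw [Set.mem_ofPred_eq, not_le, div_lt_iff₀ (sub_pos.2 hββ')] at hx
    linarith
end

section
/- Assume there exist a non-decreasing function r : ℕ → (0,∞), measurable functions W, V : X → [1,∞), a constant C₀ < ∞ and a point x₀ ∈ X such that r(k)·‖P^k(x,·) − P^k(x',·)‖_W ≤ C₀ (V(x) + V(x')) for all k ∈ ℕ and x, x' ∈ X, and sup_{k≥0} P^k W(x₀) < ∞. Then, with b := sup_{k≥0} P^k W(x₀) + C₀ V(x₀)/r(0), one has P^k W(x) ≤ (C₀/r(k)) V(x) + b for every x ∈ X and every k ∈ ℕ. -/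
open MeasureTheory ProbabilityTheory ENNReal Set Filter

variable {X : Type*} [MeasurableSpace X]

/-- first display in the proof of Theorem `Ergo2Subsample`.
Under the norm-convergence and boundedness assumptions, for every `x` and `k`,
`P^k W (x) ≤ (C₀ / r(k)) V(x) + b` with `b := sup_k P^k W(x₀) + C₀ V(x₀)/r(0)`. -/
theorem statement1
    (P : Kernel X X) [IsMarkovKernel P]
    (r : ℕ → ℝ) (hr_pos : ∀ k, 0 < r k) (hr_mono : Monotone r)
    (W V : X → ℝ) (hWmeas : Measurable W) (hVmeas : Measurable V)
    (hW1 : ∀ x, 1 ≤ W x) (hV1 : ∀ x, 1 ≤ V x)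
    (C₀ : ℝ) (hC₀ : 0 ≤ C₀) (x₀ : X)
    (hnorm : ∀ (k : ℕ) (x x' : X),
      ENNReal.ofReal (r k) * fNorm ((kernelIter P k) x) ((kernelIter P k) x') W
        ≤ ENNReal.ofReal (C₀ * (V x + V x')))
    (hx₀ : (⨆ k, kernelExp ((kernelIter P k) x₀) W) < ⊤) :
    ∀ (x : X) (k : ℕ),
      kernelExp ((kernelIter P k) x) W ≤
        ENNReal.ofReal (C₀ / r k * V x) +
          ((⨆ j, kernelExp ((kernelIter P j) x₀) W) + ENNReal.ofReal (C₀ * V x₀ / r 0)) := by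
  intro x k
  have hpos := hr_pos k
  have hbound : fNorm ((kernelIter P k) x) ((kernelIter P k) x₀) W
      ≤ ENNReal.ofReal (C₀ / r k * V x) + ENNReal.ofReal (C₀ * V x₀ / r 0) := by
    have hVx : 0 ≤ V x := zero_le_one.trans (hV1 x)
    have hVx₀ : 0 ≤ V x₀ := zero_le_one.trans (hV1 x₀)
    have h0 := hr_pos 0
    have hdiv : C₀ * V x₀ / r k ≤ C₀ * V x₀ / r 0 :=
      div_le_div_of_nonneg_left (mul_nonneg hC₀ hVx₀) h0 (hr_mono (Nat.zero_le k))
    calc fNorm ((kernelIter P k) x) ((kernelIter P k) x₀) W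
        ≤ ENNReal.ofReal (C₀ * (V x + V x₀)) / ENNReal.ofReal (r k) := by
          rw [ENNReal.le_div_iff_mul_le (Or.inl (ENNReal.ofReal_pos.2 hpos).ne')
            (Or.inl ENNReal.ofReal_ne_top), mul_comm]
          exact hnorm k x x₀
      _ = ENNReal.ofReal (C₀ / r k * V x + C₀ * V x₀ / r k) := by
          rw [← ENNReal.ofReal_div_of_pos hpos]
          congr 1
          ring
      _ ≤ ENNReal.ofReal (C₀ / r k * V x + C₀ * V x₀ / r 0) := by gcongr
      _ = _ := ENNReal.ofReal_add (by positivity) (by positivity)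
  calc kernelExp ((kernelIter P k) x) W
      ≤ kernelExp ((kernelIter P k) x₀) W
          + fNorm ((kernelIter P k) x) ((kernelIter P k) x₀) W := kernelExp_le_add_fNorm _ _ W
    _ ≤ (⨆ j, kernelExp ((kernelIter P j) x₀) W)
          + (ENNReal.ofReal (C₀ / r k * V x) + ENNReal.ofReal (C₀ * V x₀ / r 0)) :=
        add_le_add (le_iSup (fun j => kernelExp ((kernelIter P j) x₀) W) k) hbound
    _ = _ := by rw [add_left_comm]
end

section
/- Assume there exist a measurable set C, a constant b < ∞, a measurable function V : X → [1,∞) and a continuously differentiable increasing concave function φ : [1,∞) → (0,∞) such that P V ≤ V − φ∘V + b·1_C pointwise, sup_{x∈C} V(x) < ∞, and inf_{t≥1} φ(t) > 0. Then there exists b' < ∞ such that P V(x) ≤ V(x) − φ(V(x)) + b'·1_C(x) and P(φ∘V)(x) ≤ φ(V(x)) + b'·1_C(x) for all x ∈ X; that is, the pair of drift inequalities P V ≤ V − W + b'·1_C and P W ≤ W + b'·1_C holds with W proportional to φ∘V. -/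
open MeasureTheory ProbabilityTheory ENNReal Set Filter

variable {X : Type*} [MeasurableSpace X]

/-- A concave function differentiable on its domain lies below its tangent lines. -/
lemma ConcaveOn.le_add_derivWithin_mul_sub {S : Set ℝ} {f : ℝ → ℝ} (hf : ConcaveOn ℝ S f)
    {x y : ℝ} (hx : x ∈ S) (hy : y ∈ S) (hfd : DifferentiableWithinAt ℝ f S x) :
    f y ≤ f x + derivWithin f S x * (y - x) := by
  rcases lt_trichotomy x y with h | rfl | h
  · have hs := hf.slope_le_derivWithin hx hy h hfd
    rw [slope_def_field, div_le_iff₀ (sub_pos.2 h)] at hs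
    linarith
  · simp
  · have hs := hf.derivWithin_le_slope hy hx h hfd
    rw [slope_def_field, le_div_iff₀ (sub_pos.2 h)] at hs
    linarith

/-- If `f ≤ a + s (g - w)` pointwise with `s ≥ 0`, an upper bound `m` on the mean of `g` gives the
upper bound `a + s (m - w)` on the mean of `f`. -/
lemma kernelExp_le_of_le_affine (μ : Measure X) [IsProbabilityMeasure μ] {f g : X → ℝ}
    {a s w m : ℝ} (hf : ∀ y, 0 ≤ f y) (ha : 0 ≤ a) (hs : 0 ≤ s) (hw : 0 ≤ w) (hm : 0 ≤ m)
    (hfg : ∀ y, f y ≤ a + s * (g y - w)) (hg : kernelExp μ g ≤ ENNReal.ofReal m) :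
    kernelExp μ f ≤ ENNReal.ofReal (a + s * (m - w)) := by
  have hsw : 0 ≤ s * w := mul_nonneg hs hw
  have key : kernelExp μ f + ENNReal.ofReal (s * w) ≤ ENNReal.ofReal (a + s * m) := calc
    kernelExp μ f + ENNReal.ofReal (s * w)
        = ∫⁻ y, (ENNReal.ofReal (f y) + ENNReal.ofReal (s * w)) ∂μ := by
      rw [lintegral_add_right _ measurable_const]
      simp [kernelExp]
    _ ≤ ∫⁻ y, (ENNReal.ofReal a + ENNReal.ofReal s * ENNReal.ofReal (g y)) ∂μ := by
      refine lintegral_mono fun y => ?_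
      rw [← ENNReal.ofReal_add (hf y) hsw, ← ENNReal.ofReal_mul hs]
      refine (ENNReal.ofReal_le_ofReal ?_).trans ENNReal.ofReal_add_le
      linarith [hfg y]
    _ = ENNReal.ofReal a + ENNReal.ofReal s * kernelExp μ g := by
      rw [lintegral_add_left measurable_const, lintegral_const_mul' _ _ ENNReal.ofReal_ne_top]
      simp [kernelExp]
    _ ≤ ENNReal.ofReal a + ENNReal.ofReal s * ENNReal.ofReal m := by gcongr
    _ = ENNReal.ofReal (a + s * m) := by
      rw [← ENNReal.ofReal_mul hs, ← ENNReal.ofReal_add ha (mul_nonneg hs hm)]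
  calc kernelExp μ f ≤ ENNReal.ofReal (a + s * m) - ENNReal.ofReal (s * w) :=
        ENNReal.le_sub_of_add_le_right ENNReal.ofReal_ne_top key
    _ = ENNReal.ofReal (a + s * (m - w)) := by
      rw [← ENNReal.ofReal_sub _ hsw]
      ring_nf

/-- Proposition `Drift2Ergod`.  A single subgeometric drift condition
`PV ≤ V - φ∘V + b 1_C`, with `φ` continuously differentiable, increasing, concave, bounded
below away from `0` on `[1,∞)`, and `sup_C V < ∞`, implies the pair of drift conditions
`PV ≤ V - W + b' 1_C` and `PW ≤ W + b' 1_C` with `W = φ∘V`. -/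
theorem statement3
    (P : Kernel X X) [IsMarkovKernel P]
    (C : Set X) (hCmeas : MeasurableSet C) (b : ℝ) (hb : 0 ≤ b)
    (V : X → ℝ) (hVmeas : Measurable V) (hV1 : ∀ x, 1 ≤ V x)
    (φ : ℝ → ℝ) (hφdiff : ContDiffOn ℝ 1 φ (Set.Ici 1))
    (hφmono : StrictMonoOn φ (Set.Ici 1)) (hφconc : ConcaveOn ℝ (Set.Ici 1) φ)
    (hφpos : ∀ t : ℝ, 1 ≤ t → 0 < φ t)
    (hφinf : ∃ ε : ℝ, 0 < ε ∧ ∀ t : ℝ, 1 ≤ t → ε ≤ φ t)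
    (hdrift : ∀ x, kernelExp (P x) V + ENNReal.ofReal (φ (V x))
        ≤ ENNReal.ofReal (V x + b * Set.indicator C (fun _ => 1) x))
    (hVC : ∃ M : ℝ, ∀ x ∈ C, V x ≤ M) :
    ∃ b' : ℝ, 0 ≤ b' ∧
      (∀ x, kernelExp (P x) V + ENNReal.ofReal (φ (V x))
          ≤ ENNReal.ofReal (V x + b' * Set.indicator C (fun _ => 1) x)) ∧
      (∀ x, kernelExp (P x) (fun y => φ (V y))
          ≤ ENNReal.ofReal (φ (V x) + b' * Set.indicator C (fun _ => 1) x)) := by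
  have hd : DifferentiableOn ℝ φ (Set.Ici 1) := hφdiff.differentiableOn one_ne_zero
  have hder (t : ℝ) : 0 ≤ derivWithin φ (Set.Ici 1) t := hφmono.monotoneOn.derivWithin_nonneg
  have hind (x : X) : (0 : ℝ) ≤ Set.indicator C (fun _ => 1) x :=
    Set.indicator_nonneg (fun _ _ => zero_le_one) x
  have hKb : 0 ≤ derivWithin φ (Set.Ici 1) 1 * b := mul_nonneg (hder 1) hb
  refine ⟨b + derivWithin φ (Set.Ici 1) 1 * b, by positivity, fun x => ?_, fun x => ?_⟩
  · refine (hdrift x).trans (ENNReal.ofReal_le_ofReal ?_)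
    have := hind x
    gcongr
    linarith
  · have hslope : derivWithin φ (Set.Ici 1) (V x) ≤ derivWithin φ (Set.Ici 1) 1 :=
      hφconc.antitoneOn_derivWithin hd (Set.mem_Ici.2 le_rfl) (hV1 x) (hV1 x)
    have hV0 : 0 ≤ V x := zero_le_one.trans (hV1 x)
    have hbi := mul_nonneg hb (hind x)
    refine (kernelExp_le_of_le_affine (P x) (fun y => (hφpos _ (hV1 y)).le) (hφpos _ (hV1 x)).le
      (hder (V x)) hV0 (add_nonneg hV0 hbi)
      (fun y => hφconc.le_add_derivWithin_mul_sub (hV1 x) (hV1 y) (hd _ (hV1 x)))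
      (le_self_add.trans (hdrift x))).trans (ENNReal.ofReal_le_ofReal ?_)
    nlinarith [mul_le_mul_of_nonneg_right hslope hbi]
end

section
/- Assume there exist a measurable set C and a non-decreasing function r : ℕ → (0,∞) with r(0) ≥ 1 such that sup_{x∈C} 𝔼_x[∑_{k=1}^{τ_C} r(k)] < ∞. Define V(x) := 𝔼_x[∑_{k=0}^{σ_C} r(k)] and W(x) := 𝔼_x[r(σ_C)]. Then there exists b < ∞ such that P V(x) ≤ V(x) − W(x) + b·1_C(x) and P W(x) ≤ W(x) + b·1_C(x) for all x ∈ X. -/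
open MeasureTheory ProbabilityTheory ENNReal Set Filter

variable {X : Type*} [MeasurableSpace X]

/-- `𝔼ₓ[∑_{k=1}^{τ_C} r(k)]`, expressed via `∑_{k≥1} r(k) ℙₓ(τ_C ≥ k)`. -/
noncomputable def retSumExp (P : Kernel X X) (C : Set X) (r : ℕ → ℝ) (x : X) : ℝ≥0∞ :=
  ∑' k, ENNReal.ofReal (r (k + 1)) * survival P C k x

/-- `V(x) = 𝔼ₓ[∑_{k=0}^{σ_C} r(k)]`, expressed via `∑_{k≥0} r(k) ℙₓ(σ_C ≥ k)`. -/
noncomputable def hitSumExp (P : Kernel X X) (C : Set X) (r : ℕ → ℝ) (x : X) : ℝ≥0∞ :=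
  ∑' k, ENNReal.ofReal (r k) * hitSurvival P C k x

/-- `W(x) = 𝔼ₓ[r(σ_C)]`, expressed via `∑_k r(k) ℙₓ(σ_C = k) + r(∞) ℙₓ(σ_C = ∞)`. -/
noncomputable def hitTimeExp (P : Kernel X X) (C : Set X) (r : ℕ → ℝ) (x : X) : ℝ≥0∞ :=
  (∑' k, ENNReal.ofReal (r k) * (hitSurvival P C k x - hitSurvival P C (k + 1) x))
    + (⨆ k, ENNReal.ofReal (r k)) * ⨅ k, hitSurvival P C k x

/-- The sequence inequality behind both drift conditions: `∑ a k * s (k + 1)` plus the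
expectation of `a` under the law with tail `s` is at most `∑ a k * s k`. -/
theorem tsum_mul_succ_add_le {a s : ℕ → ℝ≥0∞} (ha : ∀ k, 1 ≤ a k) (hs : Antitone s) :
    (∑' k, a k * s (k + 1)) + ((∑' k, a k * (s k - s (k + 1))) + (⨆ k, a k) * ⨅ k, s k)
      ≤ ∑' k, a k * s k := by
  rcases eq_or_ne (⨅ k, s k) 0 with h0 | h0
  · rw [h0, mul_zero, add_zero, ← ENNReal.tsum_add]
    refine ENNReal.tsum_le_tsum fun k => ?_
    rw [← mul_add, add_tsub_cancel_of_le (hs k.le_succ)]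
  · have htop : ∑' k, a k * s k = ⊤ := by
      rw [eq_top_iff, ← ENNReal.tsum_const_eq_top_of_ne_zero (α := ℕ) h0]
      exact ENNReal.tsum_le_tsum fun k =>
        (iInf_le s k).trans (le_mul_of_one_le_left zero_le (ha k))
    exact htop ▸ le_top

theorem measurable_hitSurvival (P : Kernel X X) {C : Set X} (hC : MeasurableSet C) (n : ℕ) :
    Measurable (hitSurvival P C n) := by
  induction n with
  | zero => exact measurable_const
  | succ n ih => exact (Measurable.lintegral_kernel ih).indicator hC.compl

theorem hitSurvival_succ (P : Kernel X X) (C : Set X) (n : ℕ) (x : X) :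
    hitSurvival P C (n + 1) x = Cᶜ.indicator (fun x' => ∫⁻ y, hitSurvival P C n y ∂(P x')) x :=
  rfl

theorem lintegral_hitSurvival_of_notMem (P : Kernel X X) {C : Set X} (n : ℕ) {x : X}
    (hx : x ∉ C) : ∫⁻ y, hitSurvival P C n y ∂(P x) = hitSurvival P C (n + 1) x := by
  rw [hitSurvival_succ, indicator_of_mem (mem_compl hx)]

theorem hitSurvival_succ_le (P : Kernel X X) [IsMarkovKernel P] (C : Set X) (n : ℕ) (x : X) :
    hitSurvival P C (n + 1) x ≤ hitSurvival P C n x := by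
  induction n generalizing x with
  | zero =>
    rw [hitSurvival_succ]
    refine (indicator_le_self _ _ _).trans ?_
    simp [hitSurvival, hitTaboo]
  | succ n ih =>
    rw [hitSurvival_succ, hitSurvival_succ]
    exact indicator_le_indicator (lintegral_mono ih)

theorem antitone_hitSurvival (P : Kernel X X) [IsMarkovKernel P] (C : Set X) (x : X) :
    Antitone fun n => hitSurvival P C n x :=
  antitone_nat_of_succ_le fun n => hitSurvival_succ_le P C n x

theorem hitSurvival_le_one (P : Kernel X X) [IsMarkovKernel P] (C : Set X) (n : ℕ) (x : X) :
    hitSurvival P C n x ≤ 1 :=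
  antitone_hitSurvival P C x n.zero_le

theorem lintegral_hitSurvival_ne_top (P : Kernel X X) [IsMarkovKernel P] (C : Set X) (n : ℕ)
    (x : X) : ∫⁻ y, hitSurvival P C n y ∂(P x) ≠ ⊤ := by
  refine ne_top_of_le_ne_top one_ne_top ?_
  calc ∫⁻ y, hitSurvival P C n y ∂(P x) ≤ ∫⁻ _, 1 ∂(P x) :=
        lintegral_mono (hitSurvival_le_one P C n)
    _ = 1 := by simp

/-- One step of the chain turns the hitting time `σ_C` into the return time `τ_C`. -/
theorem lintegral_hitSurvival (P : Kernel X X) [IsMarkovKernel P] (C : Set X) (n : ℕ) (x : X) :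
    ∫⁻ y, hitSurvival P C n y ∂(P x) = survival P C n x := by
  induction n generalizing x with
  | zero => simp [hitSurvival, hitTaboo, survival, retTaboo]
  | succ n ih =>
    simp only [hitSurvival_succ, ih]
    rfl

theorem lintegral_hitSumExp (P : Kernel X X) {C : Set X} (hC : MeasurableSet C) (r : ℕ → ℝ)
    (x : X) : ∫⁻ y, hitSumExp P C r y ∂(P x)
      = ∑' k, ENNReal.ofReal (r k) * ∫⁻ y, hitSurvival P C k y ∂(P x) := by
  have hm := measurable_hitSurvival P hC
  simp only [hitSumExp]
  rw [lintegral_tsum fun k => ((hm k).const_mul _).aemeasurable]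
  exact tsum_congr fun k => lintegral_const_mul _ (hm k)

theorem lintegral_hitTimeExp (P : Kernel X X) [IsMarkovKernel P] {C : Set X}
    (hC : MeasurableSet C) (r : ℕ → ℝ) (x : X) :
    ∫⁻ y, hitTimeExp P C r y ∂(P x)
      = (∑' k, ENNReal.ofReal (r k) *
          (∫⁻ y, hitSurvival P C k y ∂(P x) - ∫⁻ y, hitSurvival P C (k + 1) y ∂(P x)))
        + (⨆ k, ENNReal.ofReal (r k)) * ⨅ k, ∫⁻ y, hitSurvival P C k y ∂(P x) := by
  have hm := measurable_hitSurvival P hC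
  have hd (k : ℕ) : Measurable fun y => hitSurvival P C k y - hitSurvival P C (k + 1) y :=
    (hm k).sub (hm (k + 1))
  simp only [hitTimeExp]
  rw [lintegral_add_right _ ((Measurable.iInf hm).const_mul _),
    lintegral_tsum fun k => ((hd k).const_mul _).aemeasurable,
    lintegral_const_mul _ (Measurable.iInf hm),
    lintegral_iInf hm (fun _ _ h y => antitone_hitSurvival P C y h)
      (lintegral_hitSurvival_ne_top P C 0 x)]
  congr 1
  refine tsum_congr fun k => ?_
  rw [lintegral_const_mul _ (hd k), lintegral_sub (hm (k + 1))
    (lintegral_hitSurvival_ne_top P C (k + 1) x) (ae_of_all _ (hitSurvival_succ_le P C k))]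

theorem lintegral_hitSumExp_le_retSumExp (P : Kernel X X) [IsMarkovKernel P] {C : Set X}
    (hC : MeasurableSet C) {r : ℕ → ℝ} (hr : Monotone r) (x : X) :
    ∫⁻ y, hitSumExp P C r y ∂(P x) ≤ retSumExp P C r x := by
  simp only [lintegral_hitSumExp P hC, lintegral_hitSurvival, retSumExp]
  gcongr
  exact hr (Nat.le_succ _)

theorem hitTimeExp_le_hitSumExp (P : Kernel X X) [IsMarkovKernel P] (C : Set X) {r : ℕ → ℝ}
    (hr : ∀ k, 1 ≤ ENNReal.ofReal (r k)) (x : X) : hitTimeExp P C r x ≤ hitSumExp P C r x :=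
  le_add_self.trans (tsum_mul_succ_add_le hr (antitone_hitSurvival P C x))

theorem hitTimeExp_of_mem (P : Kernel X X) {C : Set X} (r : ℕ → ℝ) {x : X}
    (hx : x ∈ C) : hitTimeExp P C r x = ENNReal.ofReal (r 0) := by
  have hs (k : ℕ) : hitSurvival P C (k + 1) x = 0 := by
    rw [hitSurvival_succ, indicator_of_notMem (notMem_compl_iff.2 hx)]
  have hinf : ⨅ k, hitSurvival P C k x = 0 := le_antisymm ((iInf_le _ 1).trans (hs 0).le) zero_le
  rw [hitTimeExp, hinf, mul_zero, add_zero, tsum_eq_single 0]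
  · rw [hs 0, tsub_zero]
    exact mul_one _
  · rintro (_ | k) hk
    · exact absurd rfl hk
    · simp [hs]

theorem lintegral_hitTimeExp_le_of_notMem (P : Kernel X X) [IsMarkovKernel P] {C : Set X}
    (hC : MeasurableSet C) {r : ℕ → ℝ} (hr : Monotone r) {x : X} (hx : x ∉ C) :
    ∫⁻ y, hitTimeExp P C r y ∂(P x) ≤ hitTimeExp P C r x := by
  rw [lintegral_hitTimeExp P hC, hitTimeExp]
  simp only [lintegral_hitSurvival_of_notMem P _ hx]
  rw [(antitone_hitSurvival P C x).iInf_nat_add 1]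
  refine add_le_add_left ?_ _
  rw [tsum_eq_zero_add' (f := fun k => ENNReal.ofReal (r k) *
    (hitSurvival P C k x - hitSurvival P C (k + 1) x)) ENNReal.summable]
  refine le_add_left (ENNReal.tsum_le_tsum fun k => ?_)
  gcongr
  exact hr k.le_succ

/-- Proposition `Moment2Ergod`.  If
`sup_{x ∈ C} 𝔼ₓ[∑_{k=1}^{τ_C} r(k)] < ∞` for a nondecreasing rate `r` with `r(0) ≥ 1`, then
the pair of drift conditions `PV ≤ V - W + b 1_C`, `PW ≤ W + b 1_C` holds with
`V(x) = 𝔼ₓ[∑_{k=0}^{σ_C} r(k)]` and `W(x) = 𝔼ₓ[r(σ_C)]`. -/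
theorem statement4
    (P : Kernel X X) [IsMarkovKernel P]
    (C : Set X) (hCmeas : MeasurableSet C)
    (r : ℕ → ℝ) (hr0 : 1 ≤ r 0) (hrmono : Monotone r)
    (hmom : ∃ M : ℝ, ∀ x ∈ C, retSumExp P C r x ≤ ENNReal.ofReal M) :
    ∃ b : ℝ≥0∞, b ≠ ⊤ ∧
      (∀ x : X,
        (∫⁻ y, hitSumExp P C r y ∂(P x)) + hitTimeExp P C r x
          ≤ hitSumExp P C r x + b * Set.indicator C (fun _ => (1 : ℝ≥0∞)) x) ∧
      (∀ x : X,
        (∫⁻ y, hitTimeExp P C r y ∂(P x))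
          ≤ hitTimeExp P C r x + b * Set.indicator C (fun _ => (1 : ℝ≥0∞)) x) := by
  obtain ⟨M, hM⟩ := hmom
  have hr (k : ℕ) : 1 ≤ ENNReal.ofReal (r k) :=
    ENNReal.one_le_ofReal.2 (hr0.trans (hrmono k.zero_le))
  refine ⟨ENNReal.ofReal M + ENNReal.ofReal (r 0), by simp, fun x => ?_, fun x => ?_⟩
  · by_cases hx : x ∈ C
    · rw [indicator_of_mem hx, mul_one, hitTimeExp_of_mem P r hx]
      refine le_add_left ?_
      gcongr
      exact (lintegral_hitSumExp_le_retSumExp P hCmeas hrmono x).trans (hM x hx)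
    · rw [indicator_of_notMem hx, mul_zero, add_zero, lintegral_hitSumExp P hCmeas]
      simp only [lintegral_hitSurvival_of_notMem P _ hx]
      exact tsum_mul_succ_add_le hr (antitone_hitSurvival P C x)
  · by_cases hx : x ∈ C
    · rw [indicator_of_mem hx, mul_one]
      refine le_add_left (le_add_right ?_)
      exact (lintegral_mono (hitTimeExp_le_hitSumExp P C hr)).trans
        ((lintegral_hitSumExp_le_retSumExp P hCmeas hrmono x).trans (hM x hx))
    · rw [indicator_of_notMem hx, mul_zero, add_zero]
      exact lintegral_hitTimeExp_le_of_notMem P hCmeas hrmono hx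
end

section
/- Let f : X → [1,∞) and n : X → {1,2,…} be measurable functions and let (r(k))_{k≥0} be a non-negative sequence. Assume there exist measurable functions V_k, S_k : X → [1,∞) for k ≥ 0 and a measurable set C such that for every k ≥ 0 and every x ∈ X, 𝔼_x[V_{k+n(x)}(Φ_{n(x)})] ≤ V_k(x) − 𝔼_x[∑_{j=0}^{n(x)−1} r(k+j) f(Φ_j)] + S_k(x)·1_C(x). Then for every x ∈ X, 𝔼_x[∑_{k=0}^{τ_C − 1} r(k) f(Φ_k)] ≤ V_0(x) + S_0(x)·1_C(x). -/
open MeasureTheory ProbabilityTheory ENNReal Set Filter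

variable {X : Type*} [MeasurableSpace X]

theorem lintegral_kernelIter_zero (P : Kernel X X) {g : X → ℝ≥0∞} (hg : Measurable g) (x : X) :
    ∫⁻ y, g y ∂(kernelIter P 0 x) = g x := by
  rw [kernelIter, Kernel.id_apply, lintegral_dirac' _ hg]

theorem lintegral_kernelIter_succ (P : Kernel X X) {g : X → ℝ≥0∞} (hg : Measurable g)
    (m : ℕ) (x : X) :
    ∫⁻ y, g y ∂(kernelIter P (m + 1) x) = ∫⁻ y, ∫⁻ z, g z ∂(kernelIter P m y) ∂(P x) := by
  rw [kernelIter, Kernel.lintegral_comp _ _ _ hg]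

theorem measurable_retTaboo (P : Kernel X X) {C : Set X} (hC : MeasurableSet C)
    {g : X → ℝ≥0∞} (hg : Measurable g) (m : ℕ) : Measurable (retTaboo P C g m) := by
  induction m with
  | zero => exact hg
  | succ m ih => exact (ih.indicator hC.compl).lintegral_kernel

/-- Dropping the taboo restriction can only increase the expectation. -/
theorem retTaboo_le_lintegral_kernelIter (P : Kernel X X) (C : Set X)
    {g : X → ℝ≥0∞} (hg : Measurable g) (m : ℕ) (x : X) :
    retTaboo P C g m x ≤ ∫⁻ y, g y ∂(kernelIter P m x) := by
  induction m generalizing x with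
  | zero => exact (lintegral_kernelIter_zero P hg x).ge
  | succ m ih =>
    rw [lintegral_kernelIter_succ P hg]
    exact lintegral_mono fun y => (indicator_le_self _ _ y).trans (ih y)

theorem sum_mul_retTaboo_succ (P : Kernel X X) {C : Set X} (hC : MeasurableSet C)
    {f : X → ℝ≥0∞} (hf : Measurable f) (s : Finset ℕ) (c : ℕ → ℝ≥0∞) (m : ℕ) (x : X) :
    ∑ j ∈ s, c j * retTaboo P C f (m + 1 + j) x
      = ∫⁻ y, Cᶜ.indicator (fun z => ∑ j ∈ s, c j * retTaboo P C f (m + j) z) y ∂(P x) := by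
  have hmeas (j : ℕ) : Measurable (Cᶜ.indicator (retTaboo P C f (m + j))) :=
    (measurable_retTaboo P hC hf _).indicator hC.compl
  have hind (y : X) : Cᶜ.indicator (fun z => ∑ j ∈ s, c j * retTaboo P C f (m + j) z) y
      = ∑ j ∈ s, c j * Cᶜ.indicator (retTaboo P C f (m + j)) y := by
    by_cases hy : y ∈ C <;> simp [hy]
  simp_rw [hind]
  rw [lintegral_finsetSum _ fun j _ => (hmeas j).const_mul _]
  refine Finset.sum_congr rfl fun j _ => ?_
  rw [lintegral_const_mul _ (hmeas j), add_right_comm, retTaboo]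

/-- Markov property at time `m + 1` for weighted sums of taboo expectations: a bound outside `C`
for the sum started afresh propagates to the sum delayed by `m + 1` steps. -/
theorem sum_mul_retTaboo_add_le (P : Kernel X X) {C : Set X} (hC : MeasurableSet C)
    {f g : X → ℝ≥0∞} (hf : Measurable f) (hg : Measurable g) (s : Finset ℕ) (c : ℕ → ℝ≥0∞)
    (h : ∀ y ∉ C, ∑ j ∈ s, c j * retTaboo P C f j y ≤ g y) (m : ℕ) (x : X) :
    ∑ j ∈ s, c j * retTaboo P C f (m + 1 + j) x ≤ ∫⁻ y, g y ∂(kernelIter P (m + 1) x) := by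
  induction m generalizing x with
  | zero =>
    rw [sum_mul_retTaboo_succ P hC hf, lintegral_kernelIter_succ P hg]
    refine lintegral_mono fun y => ?_
    rw [lintegral_kernelIter_zero P hg]
    exact indicator_apply_le fun hy => by simpa using h y hy
  | succ m ih =>
    rw [sum_mul_retTaboo_succ P hC hf, lintegral_kernelIter_succ P hg]
    exact lintegral_mono fun y => (indicator_le_self _ _ y).trans (ih y)

/-- The drift condition bounds every partial sum of taboo expectations, at every starting time. -/
theorem sum_range_mul_retTaboo_le_of_drift (P : Kernel X X) {C : Set X} (hC : MeasurableSet C)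
    {f : X → ℝ≥0∞} (hf : Measurable f) {n : X → ℕ} (hn : ∀ x, 1 ≤ n x) (c : ℕ → ℝ≥0∞)
    {V S : ℕ → X → ℝ≥0∞} (hV : ∀ k, Measurable (V k))
    (hdrift : ∀ (k : ℕ) (x : X),
      (∫⁻ y, V (k + n x) y ∂(kernelIter P (n x) x))
          + ∑ j ∈ Finset.range (n x), c (k + j) * ∫⁻ y, f y ∂(kernelIter P j x)
        ≤ V k x + S k x * C.indicator (fun _ => 1) x)
    (N k : ℕ) (x : X) :
    ∑ j ∈ Finset.range N, c (k + j) * retTaboo P C f j x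
      ≤ V k x + S k x * C.indicator (fun _ => 1) x := by
  induction N using Nat.strong_induction_on generalizing k x with
  | h N ih =>
    rcases N.eq_zero_or_pos with rfl | hN
    · simp
    obtain ⟨m, hm⟩ := Nat.exists_eq_add_of_le' (hn x)
    have hrestart (y : X) (hy : y ∉ C) :
        ∑ j ∈ Finset.range (N - n x), c (k + n x + j) * retTaboo P C f j y ≤ V (k + n x) y := by
      simpa [hy] using ih (N - n x) (by have := hn x; omega) (k + n x) y
    have htail : ∑ j ∈ Finset.range (N - n x), c (k + n x + j) * retTaboo P C f (n x + j) x
        ≤ ∫⁻ y, V (k + n x) y ∂(kernelIter P (n x) x) := by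
      have := sum_mul_retTaboo_add_le P hC hf (hV _) _ (fun j => c (k + n x + j)) hrestart m x
      rwa [← hm] at this
    calc ∑ j ∈ Finset.range N, c (k + j) * retTaboo P C f j x
        ≤ ∑ j ∈ Finset.range (n x + (N - n x)), c (k + j) * retTaboo P C f j x :=
          Finset.sum_le_sum_of_subset (Finset.range_mono (by omega))
      _ = ∑ j ∈ Finset.range (N - n x), c (k + n x + j) * retTaboo P C f (n x + j) x
          + ∑ j ∈ Finset.range (n x), c (k + j) * retTaboo P C f j x := by
          rw [Finset.sum_range_add, add_comm]
          simp only [add_assoc]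
      _ ≤ (∫⁻ y, V (k + n x) y ∂(kernelIter P (n x) x))
          + ∑ j ∈ Finset.range (n x), c (k + j) * ∫⁻ y, f y ∂(kernelIter P j x) :=
          add_le_add htail (Finset.sum_le_sum fun j _ =>
            mul_le_mul_right (retTaboo_le_lintegral_kernelIter P C hf j x) _)
      _ ≤ _ := hdrift k x

/-- Proposition `Drift:sequence`.  A family of nested state-dependent drift
conditions implies the bound
`𝔼ₓ[∑_{k=0}^{τ_C - 1} r(k) f(Φ_k)] ≤ V₀(x) + S₀(x) 1_C(x)`.
(Here `𝔼ₓ[∑_{k=0}^{τ_C - 1} r(k) f(Φ_k)] = ∑_{k≥0} r(k) 𝔼ₓ[f(Φ_k) 1_{τ_C > k}]`.) -/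
theorem statement6
    (P : Kernel X X) [IsMarkovKernel P]
    (f : X → ℝ) (hfmeas : Measurable f) (hf1 : ∀ x, 1 ≤ f x)
    (n : X → ℕ) (hnmeas : Measurable n) (hn1 : ∀ x, 1 ≤ n x)
    (r : ℕ → ℝ) (hr : ∀ k, 0 ≤ r k)
    (V S : ℕ → X → ℝ≥0∞)
    (hVmeas : ∀ k, Measurable (V k)) (hSmeas : ∀ k, Measurable (S k))
    (hV1 : ∀ k x, 1 ≤ V k x) (hS1 : ∀ k x, 1 ≤ S k x)
    (hVfin : ∀ k x, V k x ≠ ⊤) (hSfin : ∀ k x, S k x ≠ ⊤)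
    (C : Set X) (hCmeas : MeasurableSet C)
    (hdrift : ∀ (k : ℕ) (x : X),
      (∫⁻ y, V (k + n x) y ∂((kernelIter P (n x)) x))
          + ∑ j ∈ Finset.range (n x), ENNReal.ofReal (r (k + j)) *
              (∫⁻ y, ENNReal.ofReal (f y) ∂((kernelIter P j) x))
        ≤ V k x + S k x * Set.indicator C (fun _ => (1 : ℝ≥0∞)) x) :
    ∀ x : X,
      (∑' k, ENNReal.ofReal (r k) * retTaboo P C (fun y => ENNReal.ofReal (f y)) k x)
        ≤ V 0 x + S 0 x * Set.indicator C (fun _ => (1 : ℝ≥0∞)) x := by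
  intro x
  refine ENNReal.tsum_le_of_sum_range_le fun N => ?_
  simpa using sum_range_mul_retTaboo_le_of_drift P hCmeas hfmeas.ennreal_ofReal hn1
    (fun k => ENNReal.ofReal (r k)) hVmeas hdrift N 0 x
end

section
/- Let R be a strictly increasing, convex, continuously differentiable bijection of (0,∞) onto (0,∞) whose derivative R' is log-concave, and let H := R⁻¹. For each k ∈ ℕ define H_k(t) := R(H(t) + k) − R(k) for t ∈ (0,∞), equivalently H_k(t) = ∫_0^{H(t)} R'(z+k) dz. Then each H_k is increasing and concave on (0,∞), with derivative H_k'(t) = R'(H(t)+k)/R'(H(t)). -/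
open MeasureTheory ProbabilityTheory ENNReal Set Filter

variable {X : Type*} [MeasurableSpace X]

/-- If `log g` is concave on `(0,∞)`, then `t ↦ g (t + k) / g t` is non-increasing. -/
theorem div_shift_antitoneOn_of_log_concaveOn {g : ℝ → ℝ} (hpos : ∀ t ∈ Ioi (0 : ℝ), 0 < g t)
    (hg : ConcaveOn ℝ (Ioi 0) (fun t => Real.log (g t))) {k : ℝ} (hk : 0 ≤ k) :
    AntitoneOn (fun t => g (t + k) / g t) (Ioi 0) := by
  intro s hs t ht hst
  rcases hst.eq_or_lt with rfl | hlt
  · exact le_rfl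
  have hs0 : 0 < s := hs
  have ht0 : 0 < t := ht
  have hD : 0 < t + k - s := by linarith
  have hsk : s + k ∈ Ioi (0 : ℝ) := add_pos_of_pos_of_nonneg hs0 hk
  have htk : t + k ∈ Ioi (0 : ℝ) := add_pos_of_pos_of_nonneg ht0 hk
  have ha : 0 ≤ k / (t + k - s) := by positivity
  have hb : 0 ≤ (t - s) / (t + k - s) := div_nonneg (by linarith) hD.le
  have hab : k / (t + k - s) + (t - s) / (t + k - s) = 1 := by field_simp; ring
  have h₁ := hg.2 hs htk ha hb hab
  have h₂ := hg.2 hs htk hb ha (by rw [add_comm, hab])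
  have e₁ : k / (t + k - s) * s + (t - s) / (t + k - s) * (t + k) = t := by field_simp; ring
  have e₂ : (t - s) / (t + k - s) * s + k / (t + k - s) * (t + k) = s + k := by
    field_simp; ring
  simp only [smul_eq_mul, e₁, e₂] at h₁ h₂
  have hsum : Real.log (g s) + Real.log (g (t + k)) ≤ Real.log (g t) + Real.log (g (s + k)) := by
    calc Real.log (g s) + Real.log (g (t + k))
        = (k / (t + k - s) + (t - s) / (t + k - s))
            * (Real.log (g s) + Real.log (g (t + k))) := by rw [hab, one_mul]
      _ ≤ _ := by linarith
  rw [← Real.log_mul (hpos s hs).ne' (hpos _ htk).ne',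
    ← Real.log_mul (hpos t ht).ne' (hpos _ hsk).ne',
    Real.log_le_log_iff (mul_pos (hpos s hs) (hpos _ htk)) (mul_pos (hpos t ht) (hpos _ hsk))]
    at hsum
  change g (t + k) / g t ≤ g (s + k) / g s
  rw [div_le_div_iff₀ (hpos t ht) (hpos s hs)]
  linarith

/-- A strictly increasing bijection of `(0,∞)` vanishing at `0` is right-continuous at `0`. -/
theorem StrictMonoOn.continuousWithinAt_Ici_zero_of_bijOn {R : ℝ → ℝ}
    (hmono : StrictMonoOn R (Ioi 0)) (hbij : BijOn R (Ioi 0) (Ioi 0)) (hR0 : R 0 = 0) :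
    ContinuousWithinAt R (Ici 0) 0 := by
  rw [Metric.continuousWithinAt_iff]
  intro ε hε
  obtain ⟨δ, hδ, hRδ⟩ := hbij.surjOn (mem_Ioi.2 hε)
  refine ⟨δ, hδ, fun x hx hxδ => ?_⟩
  rw [hR0, dist_zero_right, Real.norm_eq_abs]
  rw [dist_zero_right, Real.norm_eq_abs, abs_of_nonneg hx] at hxδ
  rcases (mem_Ici.1 hx).eq_or_lt with rfl | hx0
  · simpa [hR0] using hε
  · rw [abs_of_pos (hbij.mapsTo hx0), ← hRδ]
    exact hmono hx0 hδ hxδ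

/-- proof of Theorem `subsampled2moments`(ii).  Let `R` be a strictly
increasing, convex, continuously differentiable bijection of `(0,∞)` onto `(0,∞)` with
log-concave derivative `R'` (and `R(0) = 0` by continuous extension), and let `H = R⁻¹`.
For `k ∈ ℕ`, the function `H_k(t) := R(H(t)+k) - R(k)` equals `∫_0^{H(t)} R'(z+k) dz`, is
increasing and concave on `(0,∞)`, and has derivative `H_k'(t) = R'(H(t)+k)/R'(H(t))`. -/
theorem statement9
    (R : ℝ → ℝ) (hRmono : StrictMonoOn R (Set.Ioi 0))
    (hRconv : ConvexOn ℝ (Set.Ioi 0) R)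
    (hRbij : Set.BijOn R (Set.Ioi 0) (Set.Ioi 0))
    (hR0 : R 0 = 0)
    (R' : ℝ → ℝ) (hR'cont : ContinuousOn R' (Set.Ioi 0))
    (hR'deriv : ∀ t ∈ Set.Ioi (0 : ℝ), HasDerivAt R (R' t) t)
    (hR'pos : ∀ t ∈ Set.Ioi (0 : ℝ), 0 < R' t)
    (hR'logconc : ConcaveOn ℝ (Set.Ioi 0) (fun t => Real.log (R' t)))
    (H : ℝ → ℝ)
    (hH : ∀ t ∈ Set.Ioi (0 : ℝ), H t ∈ Set.Ioi (0 : ℝ) ∧ R (H t) = t ∧ H (R t) = t) :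
    ∀ k : ℕ,
      (∀ t ∈ Set.Ioi (0 : ℝ),
        R (H t + k) - R k = ∫ z in (0 : ℝ)..(H t), R' (z + k)) ∧
      StrictMonoOn (fun t => R (H t + k) - R k) (Set.Ioi 0) ∧
      ConcaveOn ℝ (Set.Ioi 0) (fun t => R (H t + k) - R k) ∧
      ∀ t ∈ Set.Ioi (0 : ℝ),
        HasDerivAt (fun s => R (H s + k) - R k) (R' (H t + k) / R' (H t)) t := by
  have hHmono : StrictMonoOn H (Ioi 0) := by
    intro s hs t ht hst
    rw [← hRmono.lt_iff_lt (hH s hs).1 (hH t ht).1, (hH s hs).2.1, (hH t ht).2.1]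
    exact hst
  have hHimage : H '' Ioi 0 = Ioi 0 := by
    refine Subset.antisymm (image_subset_iff.2 fun t ht => (hH t ht).1) fun t ht => ?_
    exact ⟨R t, hRbij.mapsTo ht, (hH t ht).2.2⟩
  have hHderiv : ∀ t ∈ Ioi (0 : ℝ), HasDerivAt H (R' (H t))⁻¹ t := by
    intro t ht
    have hcont : ContinuousAt H t := hHmono.continuousAt_of_image_mem_nhds (Ioi_mem_nhds ht)
      (by rw [hHimage]; exact Ioi_mem_nhds (hH t ht).1)
    refine HasDerivAt.of_local_left_inverse hcont (hR'deriv _ (hH t ht).1)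
      (hR'pos _ (hH t ht).1).ne' ?_
    filter_upwards [Ioi_mem_nhds ht] with s hs using (hH s hs).2.1
  have hRcont : ContinuousOn R (Ici 0) := by
    intro x hx
    rcases (mem_Ici.1 hx).eq_or_lt with rfl | hx0
    · exact hRmono.continuousWithinAt_Ici_zero_of_bijOn hRbij hR0
    · exact (hR'deriv x hx0).continuousAt.continuousWithinAt
  intro k
  have hk : (0 : ℝ) ≤ k := k.cast_nonneg
  have hshift : ∀ x ∈ Ioi (0 : ℝ), x + k ∈ Ioi (0 : ℝ) := fun x hx =>
    add_pos_of_pos_of_nonneg hx hk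
  have hderiv : ∀ t ∈ Ioi (0 : ℝ),
      HasDerivAt (fun s => R (H s + k) - R k) (R' (H t + k) / R' (H t)) t := by
    intro t ht
    have h := (hR'deriv _ (hshift _ (hH t ht).1)).comp t ((hHderiv t ht).add_const (k : ℝ))
    simpa [div_eq_mul_inv, Function.comp_def] using h.sub_const (R k)
  refine ⟨fun t ht => ?_, fun s hs t ht hst => ?_, ?_, hderiv⟩
  · have hHt : 0 < H t := (hH t ht).1
    have hcont : ContinuousOn (fun z => R (z + k)) (Icc 0 (H t)) :=
      hRcont.comp (by fun_prop) fun z hz => add_nonneg hz.1 hk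
    have hd : ∀ z ∈ Ioo 0 (H t), HasDerivAt (fun z => R (z + k)) (R' (z + k)) z := fun z hz =>
      (hR'deriv _ (hshift z hz.1)).comp_add_const z k
    have hint := intervalIntegral.integrableOn_deriv_of_nonneg hcont hd
      fun z hz => (hR'pos _ (hshift z hz.1)).le
    rw [intervalIntegral.integral_eq_sub_of_hasDerivAt_of_le hHt.le hcont hd
      ((intervalIntegrable_iff_integrableOn_Ioc_of_le hHt.le).2 hint), zero_add]
  · exact sub_lt_sub_right (hRmono (hshift _ (hH s hs).1) (hshift _ (hH t ht).1)
      (by linarith [hHmono hs ht hst])) _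
  · refine AntitoneOn.concaveOn_of_deriv (convex_Ioi 0)
      (fun t ht => (hderiv t ht).continuousAt.continuousWithinAt) ?_ ?_ <;> rw [interior_Ioi]
    · exact fun t ht => (hderiv t ht).differentiableAt.differentiableWithinAt
    · intro s hs t ht hst
      rw [(hderiv s hs).deriv, (hderiv t ht).deriv]
      exact div_shift_antitoneOn_of_log_concaveOn hR'pos hR'logconc hk (hH s hs).1 (hH t ht).1
        (hHmono.monotoneOn hs ht hst)
end

section
/- Let P be phi-irreducible and aperiodic. Assume there exist measurable functions W : X → [1,∞) and n : X → {1,2,…}, constants β ∈ (0,1) and b < ∞, and a small set C with sup_{x∈C} W(x) < ∞ such that P^{n(x)} W(x) ≤ β W(x) + b·1_C(x) for all x ∈ X. Let R : (0,∞) → (0,∞) be a strictly increasing function such that (R(n))_{n∈ℕ} is a subgeometric rate sequence, and such that either (i) t ↦ R(t)/t is non-increasing and R(n(x)) ≤ W(x) for all x, or (ii) R is a convex continuously differentiable bijection of (0,∞) onto (0,∞) with log-concave derivative and R⁻¹(W(x)) − R⁻¹(β W(x)) ≥ n(x) for all x. Then for every accessible set D there exists a constant C' < ∞ such that 𝔼_x[R(τ_D)]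 ≤ C'·W(x) for all x ∈ X. -/
open MeasureTheory ProbabilityTheory ENNReal Set Filter

variable {X : Type*} [MeasurableSpace X]

namespace StateDependentDrift

/-- The function equal to the constant `a` on `D` and to `f` off `D`. -/
noncomputable def constOn {Y : Type*} (D : Set Y) (a : ℝ≥0∞) (f : Y → ℝ≥0∞) (y : Y) : ℝ≥0∞ :=
  D.indicator (fun _ => a) y + Dᶜ.indicator f y

lemma constOn_of_mem {Y : Type*} {D : Set Y} {y : Y} (hy : y ∈ D) (a : ℝ≥0∞) (f : Y → ℝ≥0∞) :
    constOn D a f y = a := by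
  simp [constOn, hy]

lemma constOn_of_notMem {Y : Type*} {D : Set Y} {y : Y} (hy : y ∉ D) (a : ℝ≥0∞) (f : Y → ℝ≥0∞) :
    constOn D a f y = f y := by
  simp [constOn, hy]

lemma measurable_constOn {D : Set X} (hD : MeasurableSet D) (a : ℝ≥0∞) {f : X → ℝ≥0∞}
    (hf : Measurable f) : Measurable (constOn D a f) :=
  (measurable_const.indicator hD).add (hf.indicator hD.compl)

/-- `truncReturn P D r k t x = 𝔼ₓ[r(t + min τ_D k)]`, where `τ_D` is the first return time
to `D`. -/
noncomputable def truncReturn (P : Kernel X X) (D : Set X) (r : ℕ → ℝ≥0∞) :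
    ℕ → ℕ → X → ℝ≥0∞
  | 0, t => fun _ => r t
  | k + 1, t => fun x => ∫⁻ y, constOn D (r (t + 1)) (truncReturn P D r k (t + 1)) y ∂(P x)

/-- `truncHit P D r k t x = 𝔼ₓ[r(t + min σ_D k)]`, where `σ_D` is the hitting time of `D`. -/
noncomputable def truncHit (P : Kernel X X) (D : Set X) (r : ℕ → ℝ≥0∞) (k t : ℕ) : X → ℝ≥0∞ :=
  constOn D (r t) (truncReturn P D r k t)

lemma measurable_lintegral_kernel (P : Kernel X X) {f : X → ℝ≥0∞} (hf : Measurable f) :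
    Measurable fun x => ∫⁻ y, f y ∂(P x) :=
  hf.lintegral_kernel

lemma lintegral_kernelIter_succ (P : Kernel X X) (k : ℕ) (x : X) {f : X → ℝ≥0∞}
    (hf : Measurable f) :
    ∫⁻ y, f y ∂(kernelIter P (k + 1) x) = ∫⁻ z, ∫⁻ y, f y ∂(kernelIter P k z) ∂(P x) := by
  rw [kernelIter, Kernel.lintegral_comp _ _ _ hf]

lemma lintegral_kernelIter_zero (P : Kernel X X) (x : X) {f : X → ℝ≥0∞}
    (hf : Measurable f) : ∫⁻ y, f y ∂(kernelIter P 0 x) = f x := by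
  rw [kernelIter, Kernel.id_apply, lintegral_dirac' x hf]

section Basic

variable {P : Kernel X X} {D : Set X} {r : ℕ → ℝ≥0∞}

lemma truncReturn_zero (t : ℕ) (x : X) : truncReturn P D r 0 t x = r t := rfl

lemma truncReturn_succ (k t : ℕ) (x : X) :
    truncReturn P D r (k + 1) t x = ∫⁻ y, truncHit P D r k (t + 1) y ∂(P x) := rfl

lemma measurable_truncReturn (hD : MeasurableSet D) (k t : ℕ) :
    Measurable (truncReturn P D r k t) := by
  induction k generalizing t with
  | zero => exact measurable_const
  | succ k ih => exact measurable_lintegral_kernel P (measurable_constOn hD _ (ih _))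

lemma measurable_truncHit (hD : MeasurableSet D) (k t : ℕ) :
    Measurable (truncHit P D r k t) :=
  measurable_constOn hD _ (measurable_truncReturn hD k t)

lemma measurable_retTaboo (hD : MeasurableSet D) {f : X → ℝ≥0∞} (hf : Measurable f) (k : ℕ) :
    Measurable (retTaboo P D f k) := by
  induction k with
  | zero => exact hf
  | succ k ih => exact measurable_lintegral_kernel P (ih.indicator hD.compl)

lemma truncHit_le_of_truncReturn_le {a : ℝ≥0∞} {k t : ℕ} {x : X} (ha : r t ≤ a)
    (h : truncReturn P D r k t x ≤ a) : truncHit P D r k t x ≤ a := by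
  by_cases hx : x ∈ D
  · rwa [truncHit, constOn_of_mem hx]
  · rwa [truncHit, constOn_of_notMem hx]

lemma retTaboo_mono {f g : X → ℝ≥0∞} (h : ∀ y, f y ≤ g y) (m : ℕ) (x : X) :
    retTaboo P D f m x ≤ retTaboo P D g m x := by
  induction m generalizing x with
  | zero => exact h x
  | succ m ih => exact lintegral_mono fun y => Set.indicator_le_indicator (ih y)

lemma retTaboo_affine (hD : MeasurableSet D) {f : X → ℝ≥0∞} (hf : Measurable f) (a b : ℝ≥0∞)
    (m : ℕ) (x : X) :
    retTaboo P D (fun y => a * f y + b) m x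
      = a * retTaboo P D f m x + b * survival P D m x := by
  induction m generalizing x with
  | zero => simp [retTaboo, survival]
  | succ m ih =>
    have h1 := (measurable_retTaboo (P := P) hD hf m).indicator hD.compl
    have h2 := (measurable_retTaboo (P := P) hD (measurable_const (a := (1 : ℝ≥0∞))) m).indicator
      hD.compl
    simp only [survival, retTaboo] at ih ⊢
    rw [← lintegral_const_mul _ h1, ← lintegral_const_mul _ h2,
      ← lintegral_add_left (h1.const_mul a)]
    refine lintegral_congr fun y => ?_
    by_cases hy : y ∈ D
    · simp [hy]
    · simpa [hy] using ih y

variable [IsMarkovKernel P]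

lemma rate_le_truncHit_and_truncReturn (hr : Monotone r) (k t : ℕ) (x : X) :
    r t ≤ truncHit P D r k t x ∧ r t ≤ truncReturn P D r k t x := by
  induction k generalizing t x with
  | zero =>
    refine ⟨?_, le_rfl⟩
    by_cases h : x ∈ D
    · rw [truncHit, constOn_of_mem h]
    · rw [truncHit, constOn_of_notMem h, truncReturn_zero]
  | succ k ih =>
    have h2 : r t ≤ truncReturn P D r (k + 1) t x := by
      rw [truncReturn_succ]
      calc r t ≤ r (t + 1) := hr (Nat.le_succ t)
        _ = ∫⁻ _, r (t + 1) ∂(P x) := by simp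
        _ ≤ _ := lintegral_mono fun y => (ih (t + 1) y).1
    refine ⟨?_, h2⟩
    by_cases h : x ∈ D
    · rw [truncHit, constOn_of_mem h]
    · rwa [truncHit, constOn_of_notMem h]

lemma rate_le_truncHit (hr : Monotone r) (k t : ℕ) (x : X) : r t ≤ truncHit P D r k t x :=
  (rate_le_truncHit_and_truncReturn hr k t x).1

lemma rate_le_truncReturn (hr : Monotone r) (k t : ℕ) (x : X) :
    r t ≤ truncReturn P D r k t x :=
  (rate_le_truncHit_and_truncReturn hr k t x).2

lemma truncHit_le_truncReturn (hr : Monotone r) (k t : ℕ) (x : X) :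
    truncHit P D r k t x ≤ truncReturn P D r k t x :=
  truncHit_le_of_truncReturn_le (rate_le_truncReturn hr k t x) le_rfl

lemma truncReturn_le_rate (hr : Monotone r) (k t : ℕ) (x : X) :
    truncReturn P D r k t x ≤ r (t + k) := by
  induction k generalizing t x with
  | zero => exact le_rfl
  | succ k ih =>
    rw [truncReturn_succ]
    calc _ ≤ ∫⁻ _, r (t + (k + 1)) ∂(P x) := lintegral_mono fun y => by
          refine truncHit_le_of_truncReturn_le (hr (by omega)) ((ih (t + 1) y).trans (hr ?_))
          omega
      _ = _ := by simp

lemma monotone_truncReturn (hr : Monotone r) (t : ℕ) (x : X) :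
    Monotone fun k => truncReturn P D r k t x := by
  refine monotone_nat_of_le_succ fun k => ?_
  induction k generalizing t x with
  | zero => exact rate_le_truncReturn hr 1 t x
  | succ k ih =>
    rw [truncReturn_succ, truncReturn_succ]
    refine lintegral_mono fun y => ?_
    by_cases hx : y ∈ D
    · simp only [truncHit, constOn_of_mem hx, le_refl]
    · simp only [truncHit, constOn_of_notMem hx]; exact ih _ _

/-- Waiting for `n` steps before looking for `D` increases the truncated hitting time. -/
lemma truncHit_le_lintegral_kernelIter (hD : MeasurableSet D) (hr : Monotone r) (n k t : ℕ)
    (x : X) :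
    truncHit P D r k t x ≤ ∫⁻ y, truncHit P D r (k - n) (t + n) y ∂(kernelIter P n x) := by
  induction n generalizing k t x with
  | zero => rw [lintegral_kernelIter_zero P x (measurable_truncHit hD _ _)]; simp
  | succ n ih =>
    rw [lintegral_kernelIter_succ P n x (measurable_truncHit hD _ _)]
    have step : truncHit P D r k t x ≤ ∫⁻ z, truncHit P D r (k - 1) (t + 1) z ∂(P x) := by
      have h0 : r t ≤ ∫⁻ z, truncHit P D r (k - 1) (t + 1) z ∂(P x) :=
        calc r t ≤ r (t + 1) := hr (Nat.le_succ t)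
          _ = ∫⁻ _, r (t + 1) ∂(P x) := by simp
          _ ≤ _ := lintegral_mono fun z => rate_le_truncHit hr _ _ z
      refine truncHit_le_of_truncReturn_le h0 ?_
      cases k with
      | zero => exact h0
      | succ k => exact (truncReturn_succ k t x).le
    refine step.trans (lintegral_mono fun z => ?_)
    have := ih (k - 1) (t + 1) z
    rwa [show k - 1 - n = k - (n + 1) by omega, show t + 1 + n = t + (n + 1) by omega] at this

lemma truncReturn_le_lintegral_kernelIter (hD : MeasurableSet D) (hr : Monotone r) {n : ℕ}
    (hn : 1 ≤ n) (k t : ℕ) (x : X) :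
    truncReturn P D r k t x ≤ ∫⁻ y, truncHit P D r (k - n) (t + n) y ∂(kernelIter P n x) := by
  cases k with
  | zero =>
    calc r t ≤ r (t + n) := hr (Nat.le_add_right t n)
      _ = ∫⁻ _, r (t + n) ∂(kernelIter P n x) := by simp
      _ ≤ _ := lintegral_mono fun z => rate_le_truncHit hr _ _ z
  | succ k =>
    obtain ⟨n, rfl⟩ : ∃ j, n = j + 1 := ⟨n - 1, by omega⟩
    rw [lintegral_kernelIter_succ P n x (measurable_truncHit hD _ _), truncReturn_succ]
    refine lintegral_mono fun z => ?_
    have := truncHit_le_lintegral_kernelIter (P := P) hD hr n k (t + 1) z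
    rwa [show k - n = k + 1 - (n + 1) by omega, show t + 1 + n = t + (n + 1) by omega] at this

/-- The truncated return time depends affinely on the rate. -/
lemma truncReturn_le_affine (hD : MeasurableSet D) {a b : ℝ≥0∞} {s t : ℕ}
    (h : ∀ j, r (t + j) ≤ a + b * r (s + j)) (k : ℕ) (x : X) :
    truncReturn P D r k t x ≤ a + b * truncReturn P D r k s x := by
  induction k generalizing s t x with
  | zero => exact h 0
  | succ k ih =>
    rw [truncReturn_succ, truncReturn_succ,
      ← lintegral_const_mul _ (measurable_truncHit hD _ _)]
    calc _ ≤ ∫⁻ y, (a + b * truncHit P D r k (s + 1) y) ∂(P x) := lintegral_mono fun y => by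
          by_cases hy : y ∈ D
          · simpa only [truncHit, constOn_of_mem hy] using h 1
          · simp only [truncHit, constOn_of_notMem hy]
            refine ih (fun j => ?_) y
            have := h (1 + j)
            rwa [← add_assoc, ← add_assoc] at this
      _ = _ := by rw [lintegral_add_left measurable_const]; simp

/-- Splitting the truncated return time according to whether `D` is reached within `m` steps. -/
lemma truncReturn_le_add_retTaboo (hr : Monotone r) (m k t : ℕ) (x : X) :
    truncReturn P D r (k + m) t x
      ≤ r (t + m) + retTaboo P D (truncReturn P D r k (t + m)) m x := by
  induction m generalizing t x with
  | zero => simp [retTaboo]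
  | succ m ih =>
    rw [← add_assoc, truncReturn_succ, retTaboo]
    calc _ ≤ ∫⁻ y, (r (t + (m + 1)) +
          Dᶜ.indicator (retTaboo P D (truncReturn P D r k (t + (m + 1))) m) y) ∂(P x) :=
          lintegral_mono fun y => by
            by_cases hy : y ∈ D
            · simpa [truncHit, constOn_of_mem hy, hy] using hr (by omega)
            · simp only [truncHit, constOn_of_notMem hy]
              have := ih (t + 1) y
              rw [show t + 1 + m = t + (m + 1) by omega] at this
              simpa [hy] using this
      _ = _ := by rw [lintegral_add_left measurable_const]; simp

lemma survival_add_kernelIter_le_one (hD : MeasurableSet D) (m : ℕ) (x : X) :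
    survival P D (m + 1) x + kernelIter P (m + 1) x D ≤ 1 := by
  have key : ∀ x, kernelIter P (m + 1) x D = ∫⁻ y, kernelIter P m y D ∂(P x) := fun x => by
    rw [kernelIter, Kernel.comp_apply' _ _ _ hD]
  have hm := (measurable_retTaboo (P := P) hD (measurable_const (a := (1 : ℝ≥0∞))) m).indicator
      hD.compl
  have hle : ∀ j (y : X), kernelIter P j y D ≤ 1 := fun j y => prob_le_one
  induction m generalizing x with
  | zero =>
    rw [key]
    simp only [survival, retTaboo] at hm ⊢
    rw [← lintegral_add_left hm]
    calc _ ≤ ∫⁻ _, 1 ∂(P x) := lintegral_mono fun y => by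
          by_cases hy : y ∈ D
          · simp [hy, hle]
          · simp [hy, kernelIter, Kernel.id_apply, hD]
      _ = 1 := by simp
  | succ m ih =>
    rw [key, survival, retTaboo, ← lintegral_add_left hm]
    calc _ ≤ ∫⁻ _, 1 ∂(P x) := lintegral_mono fun y => by
          by_cases hy : y ∈ D
          · simp only [Set.mem_compl_iff, hy, not_true_eq_false, not_false_eq_true,
              Set.indicator_of_notMem, zero_add]
            exact hle _ _
          · simp only [Set.mem_compl_iff, hy, not_false_eq_true, Set.indicator_of_mem]
            refine ih y (fun x => ?_) ?_
            · rw [kernelIter, Kernel.comp_apply' _ _ _ hD]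
            · exact (measurable_retTaboo hD measurable_const m).indicator hD.compl
      _ = 1 := by simp

/-- The part of `P^m f` that is lost by killing the chain on `D` is at least `a ℙ(τ_D ≤ m)`
if `f ≥ a`. -/
lemma retTaboo_add_le (hD : MeasurableSet D) {f : X → ℝ≥0∞} (hf : Measurable f) {a : ℝ≥0∞}
    (ha : ∀ y, a ≤ f y) (m : ℕ) (x : X) :
    retTaboo P D f m x + a ≤ ∫⁻ y, f y ∂(kernelIter P m x) + a * survival P D m x := by
  induction m generalizing x with
  | zero => rw [lintegral_kernelIter_zero P x hf]; simp [retTaboo, survival]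
  | succ m ih =>
    have h1 := (measurable_retTaboo (P := P) hD hf m).indicator hD.compl
    have h2 := (measurable_retTaboo (P := P) hD (measurable_const (a := (1 : ℝ≥0∞))) m).indicator
      hD.compl
    have h3 : a = ∫⁻ _, a ∂(P x) := by simp
    rw [lintegral_kernelIter_succ P m x hf]
    simp only [survival, retTaboo] at ih ⊢
    nth_rw 1 [h3]
    rw [← lintegral_const_mul _ h2, ← lintegral_add_left h1,
      ← lintegral_add_right _ (h2.const_mul a)]
    refine lintegral_mono fun y => ?_
    by_cases hy : y ∈ D
    · simp only [Set.mem_compl_iff, hy, not_true_eq_false, not_false_eq_true,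
        Set.indicator_of_notMem, zero_add, mul_zero, add_zero]
      calc a = ∫⁻ _, a ∂(kernelIter P m y) := by simp
        _ ≤ _ := lintegral_mono ha
    · simpa [hy] using ih y

lemma survival_succ_le (m : ℕ) (x : X) : survival P D (m + 1) x ≤ survival P D m x := by
  induction m generalizing x with
  | zero =>
    calc survival P D (0 + 1) x ≤ ∫⁻ _, 1 ∂(P x) := lintegral_mono fun y =>
          Set.indicator_le_self' (by simp) y
      _ = 1 := by simp
  | succ m ih => exact lintegral_mono fun y => Set.indicator_le_indicator (ih y)

lemma survival_le_one (m : ℕ) (x : X) : survival P D m x ≤ 1 := by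
  have := antitone_nat_of_succ_le (f := fun m => survival P D m x)
    (fun m => survival_succ_le m x) (Nat.zero_le m)
  simpa [survival, retTaboo] using this

lemma truncReturn_eq_sum (hD : MeasurableSet D) (k t : ℕ) (x : X) :
    truncReturn P D r k t x
      = ∑ j ∈ Finset.range k, r (t + (j + 1)) * (survival P D j x - survival P D (j + 1) x)
        + r (t + k) * survival P D k x := by
  have hmeas : ∀ j, Measurable (survival P D j) := fun j =>
    measurable_retTaboo hD measurable_const j
  induction k generalizing t x with
  | zero => simp [truncReturn, survival, retTaboo]
  | succ k ih =>
    have hsucc : ∀ j x, survival P D (j + 1) x = ∫⁻ y, Dᶜ.indicator (survival P D j) y ∂(P x) :=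
      fun j x => rfl
    have hdiff : ∀ j, survival P D (j + 1) x - survival P D (j + 1 + 1) x
        = ∫⁻ y, Dᶜ.indicator (fun y => survival P D j y - survival P D (j + 1) y) y ∂(P x) := by
      intro j
      have hind := (hmeas (j + 1)).indicator hD.compl
      rw [hsucc, hsucc (j + 1), ← lintegral_sub hind]
      · refine lintegral_congr fun y => ?_
        by_cases hy : y ∈ D <;> simp [hy]
      · rw [← hsucc]
        exact ((survival_le_one _ _).trans_lt one_lt_top).ne
      · exact Eventually.of_forall fun y => Set.indicator_le_indicator (survival_succ_le j y)
    have hfirst : survival P D 0 x - survival P D (0 + 1) x = P x D := by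
      have h1 : survival P D (0 + 1) x = P x Dᶜ := by
        simp [survival, retTaboo, lintegral_indicator hD.compl]
      have h2 : survival P D 0 x = 1 := rfl
      rw [h1, h2, prob_compl_eq_one_sub hD]
      exact ENNReal.sub_sub_cancel one_ne_top prob_le_one
    have hd : ∀ j, Measurable
        (Dᶜ.indicator fun y => survival P D j y - survival P D (j + 1) y) := fun j =>
      ((hmeas j).sub (hmeas (j + 1))).indicator hD.compl
    rw [Finset.sum_range_succ', hfirst, truncReturn_succ]
    simp only [hdiff]
    rw [hsucc, ← lintegral_const_mul _ ((hmeas k).indicator hD.compl)]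
    simp only [← lintegral_const_mul _ (hd _)]
    rw [← lintegral_finsetSum' _ fun j _ => ((hd j).const_mul _).aemeasurable,
      ← lintegral_indicator_const hD, ← lintegral_add_right _ (measurable_const.indicator hD),
      ← lintegral_add_right _ (((hmeas k).indicator hD.compl).const_mul _)]
    refine lintegral_congr fun y => ?_
    by_cases hy : y ∈ D
    · simp [truncHit, constOn_of_mem hy, hy]
    · simp only [truncHit, constOn_of_notMem hy, ih]
      simp [hy, add_comm, add_left_comm]

lemma expReturn_le_of_truncReturn_le (hD : MeasurableSet D) (hr : Monotone r) {x : X} {a : ℝ≥0∞}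
    (h : ∀ k, truncReturn P D r k 0 x ≤ a) : expReturn P D r x ≤ a := by
  have hs : ∀ k, ∑ j ∈ Finset.range k,
      r (j + 1) * (survival P D j x - survival P D (j + 1) x) + r k * survival P D k x ≤ a := by
    intro k
    have := h k
    rw [truncReturn_eq_sum hD] at this
    simpa using this
  rw [expReturn, ENNReal.tsum_eq_iSup_nat, ENNReal.iSup_mul]
  refine ENNReal.iSup_add_iSup_le fun i j => ?_
  refine le_trans ?_ (hs (i + j + 1))
  refine add_le_add (Finset.sum_le_sum_of_subset ?_) (mul_le_mul' (hr (by omega)) (iInf_le _ _))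
  intro l hl
  simp only [Finset.mem_range] at hl ⊢
  omega

end Basic

section Untruncated

/-- `fullReturn P D r t x = 𝔼ₓ[r(t + τ_D)]`, where `τ_D` is the first return time to `D`. -/
noncomputable def fullReturn (P : Kernel X X) (D : Set X) (r : ℕ → ℝ≥0∞) (t : ℕ) (x : X) :
    ℝ≥0∞ :=
  ⨆ k, truncReturn P D r k t x

/-- `fullHit P D r t x = 𝔼ₓ[r(t + σ_D)]`, where `σ_D` is the hitting time of `D`. -/
noncomputable def fullHit (P : Kernel X X) (D : Set X) (r : ℕ → ℝ≥0∞) (t : ℕ) (x : X) : ℝ≥0∞ :=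
  ⨆ k, truncHit P D r k t x

variable {P : Kernel X X} {C D : Set X} {r : ℕ → ℝ≥0∞}

lemma measurable_fullHit (hD : MeasurableSet D) (t : ℕ) : Measurable (fullHit P D r t) :=
  Measurable.iSup fun k => measurable_truncHit hD k t

lemma fullHit_of_mem {x : X} (hx : x ∈ D) (t : ℕ) : fullHit P D r t x = r t := by
  simp [fullHit, truncHit, constOn_of_mem hx]

lemma fullHit_of_notMem {x : X} (hx : x ∉ D) (t : ℕ) :
    fullHit P D r t x = fullReturn P D r t x := by
  simp [fullHit, fullReturn, truncHit, constOn_of_notMem hx]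

variable [IsMarkovKernel P]

lemma rate_le_fullHit (hr : Monotone r) (t : ℕ) (x : X) : r t ≤ fullHit P D r t x :=
  (rate_le_truncHit hr 0 t x).trans (le_iSup (fun k => truncHit P D r k t x) 0)

lemma monotone_truncHit (hr : Monotone r) (t : ℕ) : Monotone fun k => truncHit P D r k t := by
  intro i j hij x
  by_cases hx : x ∈ D
  · simp [truncHit, constOn_of_mem hx]
  · simpa [truncHit, constOn_of_notMem hx] using monotone_truncReturn hr t x hij

lemma lintegral_fullHit_succ_le (hD : MeasurableSet D) (hr : Monotone r) (t : ℕ) (x : X) :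
    ∫⁻ y, fullHit P D r (t + 1) y ∂(P x) ≤ fullReturn P D r t x := by
  unfold fullHit
  rw [lintegral_iSup (fun k => measurable_truncHit hD k (t + 1)) (monotone_truncHit hr (t + 1))]
  exact iSup_le fun k => (truncReturn_succ k t x).ge.trans
    (le_iSup (fun k => truncReturn P D r k t x) (k + 1))

/-- If `𝔼[r(τ_C)] ≤ M` on `C`, then the expected value of `r(t + j + σ_C)` after `j` steps of the
chain increases at most linearly in `j`. -/
lemma lintegral_kernelIter_fullHit_le (hC : MeasurableSet C) (hr : Monotone r) {ε c M : ℝ≥0∞}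
    (hadd : ∀ t, 1 ≤ t → ∀ j, r (t + j) ≤ r t + (ε * r t + c) * r j)
    (hM : ∀ x ∈ C, fullReturn P C r 0 x ≤ M) (j t : ℕ) (ht : 1 ≤ t) (x : X) :
    ∫⁻ y, fullHit P C r (t + j) y ∂(kernelIter P j x)
      ≤ fullHit P C r t x + j * ((ε * r (t + j) + c) * M) := by
  have hone : ∀ t, 1 ≤ t → ∀ x,
      fullReturn P C r t x ≤ fullHit P C r t x + (ε * r t + c) * M := by
    intro t ht x
    by_cases hx : x ∈ C
    · rw [fullHit_of_mem hx]
      refine iSup_le fun k => (truncReturn_le_affine (a := r t) (b := ε * r t + c) (s := 0) hC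
        (fun j => ?_) k x).trans ?_
      · simpa using hadd t ht j
      · gcongr
        exact (le_iSup (fun k => truncReturn P C r k 0 x) k).trans (hM x hx)
    · rw [fullHit_of_notMem hx]
      exact le_self_add
  induction j generalizing t x with
  | zero => rw [lintegral_kernelIter_zero P x (measurable_fullHit hC _)]; simp
  | succ j ih =>
    rw [lintegral_kernelIter_succ P j x (measurable_fullHit hC _)]
    have heq : t + (j + 1) = t + 1 + j := by omega
    set q := (ε * r (t + (j + 1)) + c) * M with hq
    calc _ ≤ ∫⁻ z, (fullHit P C r (t + 1) z + j * q) ∂(P x) := lintegral_mono fun z => by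
          have := ih (t + 1) (by omega) z
          rwa [← heq] at this
      _ = ∫⁻ z, fullHit P C r (t + 1) z ∂(P x) + j * q := by
          rw [lintegral_add_left (measurable_fullHit hC _)]; simp
      _ ≤ fullHit P C r t x + (ε * r t + c) * M + j * q := by
          gcongr
          exact (lintegral_fullHit_succ_le hC hr t x).trans (hone t ht x)
      _ ≤ fullHit P C r t x + q + j * q := by
          gcongr
          rw [hq]
          gcongr
          exact hr (by omega)
      _ = _ := by push_cast; ring

/-- A drift function for the chain sampled at the state-dependent times `n` bounds the hitting time
of `C`. -/
lemma truncHit_le_of_drift (hC : MeasurableSet C) (hr : Monotone r) {n : X → ℕ}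
    (hn : ∀ x, 1 ≤ n x) {V : ℕ → X → ℝ≥0∞} (hrV : ∀ t, 1 ≤ t → ∀ x, r t ≤ V t x)
    (hV : ∀ t, 1 ≤ t → ∀ x ∉ C, ∫⁻ y, V (t + n x) y ∂(kernelIter P (n x) x) ≤ V t x)
    (k t : ℕ) (ht : 1 ≤ t) (x : X) : truncHit P C r k t x ≤ V t x := by
  induction k using Nat.strong_induction_on generalizing t x with
  | _ k ih =>
    by_cases hx : x ∈ C
    · rw [truncHit, constOn_of_mem hx]
      exact hrV t ht x
    · rcases Nat.eq_zero_or_pos k with rfl | hk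
      · rw [truncHit, constOn_of_notMem hx]
        exact hrV t ht x
      · refine (truncHit_le_lintegral_kernelIter hC hr (n x) k t x).trans ((?_ : _ ≤ _).trans
          (hV t ht x hx))
        have := hn x
        exact lintegral_mono fun y => ih (k - n x) (by omega) (t + n x) (by omega) y

lemma fullReturn_le_of_drift (hC : MeasurableSet C) (hr : Monotone r) {n : X → ℕ}
    (hn : ∀ x, 1 ≤ n x) {V : ℕ → X → ℝ≥0∞} (hrV : ∀ t, 1 ≤ t → ∀ x, r t ≤ V t x)
    (hV : ∀ t, 1 ≤ t → ∀ x ∉ C, ∫⁻ y, V (t + n x) y ∂(kernelIter P (n x) x) ≤ V t x)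
    (x : X) : fullReturn P C r 0 x ≤ ∫⁻ y, V (n x) y ∂(kernelIter P (n x) x) := by
  refine iSup_le fun k => (truncReturn_le_lintegral_kernelIter hC hr (hn x) k 0 x).trans ?_
  rw [zero_add]
  exact lintegral_mono fun y => truncHit_le_of_drift hC hr hn hrV hV _ _ (hn x) y

/-- Return times to `D` are controlled by hitting times of `C` when `D` is reached from `C` within
`m` steps with probability at least `δ`. -/
lemma exists_truncReturn_le_fullHit (hC : MeasurableSet C) (hD : MeasurableSet D)
    (hr : Monotone r) (hfin : ∀ t, r t ≠ ∞) (hpos : r 1 ≠ 0)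
    (hadd : ∀ ε : NNReal, 0 < ε → ∃ c : NNReal, ∀ t, 1 ≤ t → ∀ j,
      r (t + j) ≤ r t + (ε * r t + c) * r j)
    {M : NNReal} (hM : ∀ x ∈ C, fullReturn P C r 0 x ≤ M) {m : ℕ} (hm : 1 ≤ m) {δ : NNReal}
    (hδ : 0 < δ) (hδ1 : δ ≤ 1) (hsurv : ∀ x ∈ C, survival P D m x + δ ≤ 1) :
    ∃ A B : NNReal, ∀ k t, 1 ≤ t → ∀ x,
      truncReturn P D r k t x ≤ A * fullHit P C r t x + B := by
  obtain ⟨K, hK1, hK⟩ : ∃ K : NNReal, 1 ≤ K ∧ ∀ t, 1 ≤ t → r (t + m) ≤ K * r t := by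
    obtain ⟨c, hc⟩ := hadd 1 one_pos
    have hne : r m + c / r 1 * r m ≠ ∞ := by
      have h2 : c / r 1 ≠ ∞ := ENNReal.div_ne_top coe_ne_top hpos
      exact ENNReal.add_ne_top.2 ⟨hfin m, ENNReal.mul_ne_top h2 (hfin m)⟩
    refine ⟨1 + (r m + c / r 1 * r m).toNNReal, by simp, fun t ht => (hc t ht m).trans ?_⟩
    have h3 : (c : ℝ≥0∞) ≤ c / r 1 * r t :=
      calc (c : ℝ≥0∞) = c / r 1 * r 1 := (ENNReal.div_mul_cancel hpos (hfin 1)).symm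
        _ ≤ _ := by gcongr; exact hr ht
    rw [ENNReal.coe_add, ENNReal.coe_toNNReal hne, ENNReal.coe_one]
    calc r t + (1 * r t + c) * r m ≤ r t + (1 * r t + c / r 1 * r t) * r m := by gcongr
      _ = _ := by ring
  set ε : NNReal := δ / 2 / (m * K * M + 1) with hε
  have hεpos : 0 < ε := by positivity
  have hεle : (m * (ε * K * M) : NNReal) ≤ δ / 2 := by
    rw [hε]
    calc m * (δ / 2 / (m * K * M + 1) * K * M)
        = δ / 2 * ((m * K * M) / (m * K * M + 1)) := by field_simp
      _ ≤ δ / 2 * 1 := by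
        gcongr
        exact div_le_one_of_le₀ (by simp) (by positivity)
      _ = δ / 2 := mul_one _
  obtain ⟨c, hc⟩ := hadd ε hεpos
  set c' : NNReal := m * (c * M) with hc'
  have hhit : ∀ t, 1 ≤ t → ∀ x ∈ C, ∫⁻ y, fullHit P C r (t + m) y ∂(kernelIter P m x)
      ≤ r t + (δ / 2 : NNReal) * r t + c' := by
    intro t ht x hx
    refine (lintegral_kernelIter_fullHit_le hC hr hc hM m t ht x).trans ?_
    rw [fullHit_of_mem hx]
    calc r t + m * ((ε * r (t + m) + c) * M)
        ≤ r t + m * ((ε * (K * r t) + c) * M) := by gcongr; exact hK t ht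
      _ = r t + ((m * (ε * K * M) : NNReal) : ℝ≥0∞) * r t + c' := by
        rw [hc']; push_cast; ring
      _ ≤ _ := by gcongr
  have htab : ∀ t, 1 ≤ t → ∀ x ∈ C,
      (δ / 2 : NNReal) * r t + retTaboo P D (fullHit P C r (t + m)) m x ≤ r t + c' := by
    intro t ht x hx
    have h1 := retTaboo_add_le (P := P) hD (measurable_fullHit (P := P) (r := r) hC (t + m))
      (a := r t) (fun y => (hr (Nat.le_add_right t m)).trans (rate_le_fullHit hr _ y)) m x
    set ret := retTaboo P D (fullHit P C r (t + m)) m x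
    have hcancel : r t + (δ / 2 : NNReal) * r t ≠ ∞ :=
      ENNReal.add_ne_top.2 ⟨hfin t, ENNReal.mul_ne_top coe_ne_top (hfin t)⟩
    refine (ENNReal.add_le_add_iff_left hcancel).1 ?_
    have hhalf : (δ : ℝ≥0∞) = (δ / 2 : NNReal) + (δ / 2 : NNReal) := by
      rw [← ENNReal.coe_add, add_halves]
    calc r t + (δ / 2 : NNReal) * r t + ((δ / 2 : NNReal) * r t + ret)
        = ret + r t + δ * r t := by rw [hhalf]; ring
      _ ≤ r t + (δ / 2 : NNReal) * r t + c' + r t * survival P D m x + δ * r t := by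
        refine add_le_add_left (h1.trans ?_) _
        gcongr
        exact hhit t ht x hx
      _ = r t + (δ / 2 : NNReal) * r t + c' + r t * (survival P D m x + δ) := by ring
      _ ≤ r t + (δ / 2 : NNReal) * r t + c' + r t * 1 := by gcongr; exact hsurv x hx
      _ = _ := by ring
  set A : NNReal := 2 * K / δ with hA
  have hKA : K ≤ A := by
    rw [hA, le_div_iff₀ hδ]
    calc K * δ ≤ K * 1 := by gcongr
      _ ≤ 2 * K := by rw [mul_one, two_mul]; exact le_self_add
  have hAδ : A * (δ / 2) = K := by rw [hA]; field_simp
  set B : NNReal := A * c' / δ with hB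
  have hBδ : B * δ = A * c' := by rw [hB]; field_simp
  have h1A : (1 : ℝ≥0∞) ≤ A := by exact_mod_cast hK1.trans hKA
  refine ⟨A, B, fun k => ?_⟩
  induction k using Nat.strong_induction_on with
  | _ k ih =>
    intro t ht x
    by_cases hx : x ∈ C
    · rw [fullHit_of_mem hx]
      rcases lt_or_ge k m with hkm | hkm
      · calc truncReturn P D r k t x ≤ r (t + k) := truncReturn_le_rate hr k t x
          _ ≤ r (t + m) := hr (by omega)
          _ ≤ K * r t := hK t ht
          _ ≤ A * r t := by gcongr
          _ ≤ _ := le_self_add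
      · obtain ⟨k, rfl⟩ : ∃ i, k = i + m := ⟨k - m, by omega⟩
        have hih : ∀ y, truncReturn P D r k (t + m) y ≤ A * fullHit P C r (t + m) y + B :=
          fun y => ih k (by omega) (t + m) (by omega) y
        calc truncReturn P D r (k + m) t x
            ≤ r (t + m) + retTaboo P D (truncReturn P D r k (t + m)) m x :=
              truncReturn_le_add_retTaboo hr m k t x
          _ ≤ (A * (δ / 2) : NNReal) * r t
              + (A * retTaboo P D (fullHit P C r (t + m)) m x + B * survival P D m x) := by
              rw [← retTaboo_affine hD (measurable_fullHit hC _), hAδ]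
              exact add_le_add (hK t ht) (retTaboo_mono hih m x)
          _ = A * ((δ / 2 : NNReal) * r t + retTaboo P D (fullHit P C r (t + m)) m x)
              + B * survival P D m x := by push_cast; ring
          _ ≤ A * (r t + c') + B * survival P D m x :=
              add_le_add (mul_le_mul' le_rfl (htab t ht x hx)) le_rfl
          _ = A * r t + ((A * c' : NNReal) + B * survival P D m x) := by push_cast; ring
          _ = A * r t + B * (survival P D m x + δ) := by rw [← hBδ]; push_cast; ring
          _ ≤ A * r t + B * 1 := by gcongr; exact hsurv x hx
          _ = _ := by rw [mul_one]
    · cases k with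
      | zero =>
        calc r t ≤ fullHit P C r t x := rate_le_fullHit hr t x
          _ ≤ A * fullHit P C r t x := le_mul_of_one_le_left' h1A
          _ ≤ _ := le_self_add
      | succ k =>
        rw [truncReturn_succ, fullHit_of_notMem hx]
        calc _ ≤ ∫⁻ y, (A * fullHit P C r (t + 1) y + B) ∂(P x) := lintegral_mono fun y =>
              (truncHit_le_truncReturn hr _ _ y).trans (ih k (by omega) (t + 1) (by omega) y)
          _ = A * ∫⁻ y, fullHit P C r (t + 1) y ∂(P x) + B := by
              rw [lintegral_add_right _ measurable_const,
                lintegral_const_mul _ (measurable_fullHit hC _)]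
              simp
          _ ≤ _ := by gcongr; exact lintegral_fullHit_succ_le hC hr t x

/-- An accessible set is reached from a small set within a fixed number of steps with probability
bounded below. -/
lemma exists_survival_add_le_one (hD : MeasurableSet D) (hC : IsSmallSet P C)
    (hacc : Accessible P D) :
    ∃ m : ℕ, 1 ≤ m ∧ ∃ δ : NNReal, 0 < δ ∧ δ ≤ 1 ∧ ∀ x ∈ C, survival P D m x + δ ≤ 1 := by
  obtain ⟨ε, ν, hε, hν, hsmall⟩ := hC
  obtain ⟨m, hm⟩ : ∃ m, ν {y | kernelIter P m y D ≠ 0} ≠ 0 := by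
    by_contra! hcon
    refine hν (Measure.measure_univ_eq_zero.1 (measure_mono_null ?_ (measure_iUnion_null hcon)))
    intro y _
    obtain ⟨m, -, hm⟩ := hacc y
    exact Set.mem_iUnion.2 ⟨m, hm.ne'⟩
  have hmeas : Measurable fun y => kernelIter P m y D := Kernel.measurable_coe _ hD
  have hint : ∫⁻ y, kernelIter P m y D ∂ν ≠ 0 := by
    rw [Ne, lintegral_eq_zero_iff hmeas]
    exact fun h => hm (by simpa [Filter.EventuallyEq, ae_iff] using h)
  set I := min 1 (ENNReal.ofReal ε * ∫⁻ y, kernelIter P m y D ∂ν) with hI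
  have hI0 : I ≠ 0 := by
    have : ENNReal.ofReal ε ≠ 0 := by simpa using hε
    simp [hI, this, hint]
  have hI1 : I ≤ 1 := min_le_left _ _
  have hItop : I ≠ ∞ := (hI1.trans_lt one_lt_top).ne
  refine ⟨m + 1, by omega, I.toNNReal, ENNReal.toNNReal_pos hI0 hItop, ?_, fun x hx => ?_⟩
  · rwa [← ENNReal.coe_le_coe, ENNReal.coe_toNNReal hItop]
  · rw [ENNReal.coe_toNNReal hItop]
    refine le_trans ?_ (survival_add_kernelIter_le_one (P := P) hD m x)
    gcongr
    have hle : ENNReal.ofReal ε • ν ≤ P x := Measure.le_iff.2 fun A hA => hsmall x hx A hA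
    calc I ≤ ENNReal.ofReal ε * ∫⁻ y, kernelIter P m y D ∂ν := min_le_right _ _
      _ = ∫⁻ y, kernelIter P m y D ∂(ENNReal.ofReal ε • ν) := by
        rw [lintegral_smul_measure, smul_eq_mul]
      _ ≤ ∫⁻ y, kernelIter P m y D ∂(P x) := lintegral_mono' hle le_rfl
      _ = _ := by rw [kernelIter, Kernel.comp_apply' _ _ _ hD]

/-- A drift function for the chain sampled at state-dependent times and a small set `C` give a bound
on return times to every accessible set. -/
lemma exists_expReturn_le (hC : MeasurableSet C) (hD : MeasurableSet D) (hsmall : IsSmallSet P C)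
    (hacc : Accessible P D) (hr : Monotone r) (hfin : ∀ t, r t ≠ ∞) (hpos : r 1 ≠ 0)
    (hadd : ∀ ε : NNReal, 0 < ε → ∃ c : NNReal, ∀ t, 1 ≤ t → ∀ j,
      r (t + j) ≤ r t + (ε * r t + c) * r j)
    {n : X → ℕ} (hn : ∀ x, 1 ≤ n x) {V : ℕ → X → ℝ≥0∞} (hrV : ∀ t, 1 ≤ t → ∀ x, r t ≤ V t x)
    (hV : ∀ t, 1 ≤ t → ∀ x ∉ C, ∫⁻ y, V (t + n x) y ∂(kernelIter P (n x) x) ≤ V t x)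
    {W : X → ℝ} (hW1 : ∀ x, 1 ≤ W x) {M : ℝ} (hWC : ∀ x ∈ C, W x ≤ M) {c₀ : ℝ} (hc₀ : 0 ≤ c₀)
    (hV0 : ∀ x, ∫⁻ y, V (n x) y ∂(kernelIter P (n x) x) ≤ ENNReal.ofReal (c₀ * W x)) :
    ∃ C' : ℝ, 0 ≤ C' ∧ ∀ x, expReturn P D r x ≤ ENNReal.ofReal (C' * W x) := by
  have hret : ∀ x, fullReturn P C r 0 x ≤ ENNReal.ofReal (c₀ * W x) := fun x =>
    (fullReturn_le_of_drift hC hr hn hrV hV x).trans (hV0 x)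
  have hM : ∀ x ∈ C, fullReturn P C r 0 x ≤ (c₀ * M).toNNReal := fun x hx =>
    (hret x).trans (ENNReal.ofReal_le_ofReal (mul_le_mul_of_nonneg_left (hWC x hx) hc₀))
  obtain ⟨m, hm, δ, hδ, hδ1, hsurv⟩ := exists_survival_add_le_one hD hsmall hacc
  obtain ⟨A, B, hAB⟩ :=
    exists_truncReturn_le_fullHit hC hD hr hfin hpos hadd hM hm hδ hδ1 hsurv
  refine ⟨A * c₀ + B, by positivity, fun x => expReturn_le_of_truncReturn_le hD hr fun k => ?_⟩
  calc truncReturn P D r k 0 x ≤ truncReturn P D r (k + 1) 0 x :=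
        monotone_truncReturn hr 0 x (Nat.le_succ k)
    _ ≤ ∫⁻ y, (A * fullHit P C r (0 + 1) y + B) ∂(P x) := by
        rw [truncReturn_succ]
        exact lintegral_mono fun y =>
          (truncHit_le_truncReturn hr _ _ y).trans (hAB k (0 + 1) le_rfl y)
    _ = A * ∫⁻ y, fullHit P C r (0 + 1) y ∂(P x) + B := by
        rw [lintegral_add_right _ measurable_const,
          lintegral_const_mul _ (measurable_fullHit hC _)]
        simp
    _ ≤ A * ENNReal.ofReal (c₀ * W x) + B := by
        gcongr
        exact (lintegral_fullHit_succ_le hC hr 0 x).trans (hret x)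
    _ = ENNReal.ofReal (A * (c₀ * W x) + B) := by
        have hWx : 0 ≤ W x := zero_le_one.trans (hW1 x)
        rw [ENNReal.ofReal_add (by positivity) (by positivity), ENNReal.ofReal_mul A.coe_nonneg,
          ENNReal.ofReal_coe_nnreal, ENNReal.ofReal_coe_nnreal]
    _ ≤ _ := by
        refine ENNReal.ofReal_le_ofReal ?_
        have := mul_le_mul_of_nonneg_left (hW1 x) B.coe_nonneg
        linarith

end Untruncated

section Rates

lemma SubgeometricRate.exists_succ_sub_le {r : ℕ → ℝ} (hr : SubgeometricRate r) {ε : ℝ}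
    (hε : 0 < ε) : ∃ c : ℝ, 0 ≤ c ∧ ∀ k, r (k + 1) - r k ≤ ε * r k + c := by
  obtain ⟨hr0, hmono, r₀, h₀, hmono₀, hlog, hlim, hratio⟩ := hr
  have hpos : ∀ k, 0 < r₀ k := fun k =>
    zero_lt_one.trans_le (h₀.trans (hmono₀ (Nat.zero_le k)))
  have hexp : Tendsto (fun k : ℕ => Real.exp (Real.log (r₀ k) / k)) atTop (nhds 1) := by
    simpa [Function.comp_def] using (Real.continuous_exp.tendsto 0).comp hlim
  have hleft : Tendsto (fun k : ℕ => r (k + 1) / r₀ (k + 1) * Real.exp (Real.log (r₀ k) / k))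
      atTop (nhds 1) := by
    simpa using ((tendsto_add_atTop_iff_nat 1).2 hratio).mul hexp
  have hright : Tendsto (fun k : ℕ => (1 + ε) * (r k / r₀ k)) atTop (nhds (1 + ε)) := by
    simpa using hratio.const_mul (1 + ε)
  obtain ⟨N, hN⟩ := eventually_atTop.1
    ((hleft.eventually_lt hright (by linarith)).and (eventually_ge_atTop 1))
  refine ⟨r (N + 1), hr0 _, fun k => ?_⟩
  rcases lt_or_ge k N with hk | hk
  · have h1 : r (k + 1) ≤ r (N + 1) := hmono (by omega)
    nlinarith [hr0 k]
  · obtain ⟨hlt, hk1⟩ := hN k hk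
    have hkpos : (0 : ℝ) < k := by exact_mod_cast hk1
    have hstep : r₀ (k + 1) ≤ Real.exp (Real.log (r₀ k) / k) * r₀ k := by
      have h1 := hlog k (k + 1) hk1 (Nat.le_succ k)
      rw [← Real.log_le_log_iff (hpos _) (mul_pos (Real.exp_pos _) (hpos _)),
        Real.log_mul (Real.exp_pos _).ne' (hpos _).ne', Real.log_exp]
      rw [div_le_iff₀ (by positivity)] at h1
      push_cast at h1
      have h2 : Real.log (r₀ k) / k * k = Real.log (r₀ k) := div_mul_cancel₀ _ hkpos.ne'
      linarith
    have h3 : r (k + 1) ≤ (1 + ε) * r k :=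
      calc r (k + 1) = r (k + 1) / r₀ (k + 1) * r₀ (k + 1) :=
            (div_mul_cancel₀ _ (hpos _).ne').symm
        _ ≤ r (k + 1) / r₀ (k + 1) * (Real.exp (Real.log (r₀ k) / k) * r₀ k) :=
            mul_le_mul_of_nonneg_left hstep (div_nonneg (hr0 _) (hpos _).le)
        _ = r (k + 1) / r₀ (k + 1) * Real.exp (Real.log (r₀ k) / k) * r₀ k := by ring
        _ ≤ (1 + ε) * (r k / r₀ k) * r₀ k := mul_le_mul_of_nonneg_right hlt.le (hpos k).le
        _ = (1 + ε) * r k := by rw [mul_assoc, div_mul_cancel₀ _ (hpos _).ne']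
    linarith [hr0 (N + 1)]

lemma le_add_of_antitone_div {R : ℝ → ℝ} (hR : ∀ s t : ℝ, 0 < s → s ≤ t → R t / t ≤ R s / s)
    {s t : ℝ} (hs : 0 < s) (ht : 0 < t) : R (s + t) ≤ R s + R t := by
  have h1 := hR s (s + t) hs (by linarith)
  have h2 := hR t (s + t) ht (by linarith)
  rw [le_div_iff₀ hs] at h1
  rw [le_div_iff₀ ht] at h2
  have h3 : R (s + t) = R (s + t) / (s + t) * (s + t) := (div_mul_cancel₀ _ (by positivity)).symm
  linarith

/-- Increments of a concave function over intervals of equal length decrease. -/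
lemma ConcaveOn.add_le_add_shift {g : ℝ → ℝ} (hg : ConcaveOn ℝ (Set.Ioi 0) g) {p q a : ℝ}
    (hp : 0 < p) (hpq : p ≤ q) (ha : 0 ≤ a) : g (a + q) + g p ≤ g (a + p) + g q := by
  rcases ha.eq_or_lt with rfl | ha
  · simp [add_comm]
  · have hd : 0 < a + q - p := by linarith
    have hq : (a + q) ∈ Set.Ioi (0 : ℝ) := Set.mem_Ioi.2 (by linarith)
    have hle : a / (a + q - p) ≤ 1 := (div_le_one hd).2 (by linarith)
    have hnn : 0 ≤ a / (a + q - p) := by positivity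
    have h1 := hg.2 (Set.mem_Ioi.2 hp) hq (sub_nonneg.2 hle) hnn (by ring)
    have h2 := hg.2 (Set.mem_Ioi.2 hp) hq hnn (sub_nonneg.2 hle) (by ring)
    simp only [smul_eq_mul] at h1 h2
    have e1 : (1 - a / (a + q - p)) * p + a / (a + q - p) * (a + q) = a + p := by
      field_simp; ring
    have e2 : a / (a + q - p) * p + (1 - a / (a + q - p)) * (a + q) = q := by
      field_simp; ring
    rw [e1] at h1
    rw [e2] at h2
    linarith

section LogConcave

variable {R R' : ℝ → ℝ}

lemma mul_deriv_shift_le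
    (hpos : ∀ t ∈ Set.Ioi (0 : ℝ), 0 < R' t)
    (hconc : ConcaveOn ℝ (Set.Ioi 0) fun t => Real.log (R' t))
    {p q a : ℝ} (hp : 0 < p) (hpq : p ≤ q) (ha : 0 ≤ a) :
    R' (a + q) * R' p ≤ R' (a + p) * R' q := by
  have h1 := hpos (a + q) (Set.mem_Ioi.2 (by linarith))
  have h2 := hpos p hp
  have h3 := hpos (a + p) (Set.mem_Ioi.2 (by linarith))
  have h4 := hpos q (Set.mem_Ioi.2 (by linarith))
  rw [← Real.log_le_log_iff (by positivity) (by positivity), Real.log_mul h1.ne' h2.ne',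
    Real.log_mul h3.ne' h4.ne']
  exact ConcaveOn.add_le_add_shift hconc hp hpq ha

/-- Tangent line bound for the concave function `w ↦ R (a + R⁻¹ w)` at `w = R v₀`. -/
lemma shift_sub_le_of_logConcave_deriv
    (hder : ∀ t ∈ Set.Ioi (0 : ℝ), HasDerivAt R (R' t) t)
    (hpos : ∀ t ∈ Set.Ioi (0 : ℝ), 0 < R' t)
    (hconc : ConcaveOn ℝ (Set.Ioi 0) fun t => Real.log (R' t))
    {a v₀ v : ℝ} (ha : 0 ≤ a) (hv₀ : 0 < v₀) (hv : 0 < v) :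
    R (a + v) - R (a + v₀) ≤ R' (a + v₀) / R' v₀ * (R v - R v₀) := by
  set B := R' (a + v₀) / R' v₀ with hB
  have hBmul : B * R' v₀ = R' (a + v₀) := div_mul_cancel₀ _ (hpos v₀ hv₀).ne'
  have hf : ∀ u, 0 < u →
      HasDerivAt (fun u => B * R u - R (a + u)) (B * R' u - R' (a + u)) u := by
    intro u hu
    have h1 := (hder (a + u) (Set.mem_Ioi.2 (by linarith))).comp_const_add a u
    exact ((hder u hu).const_mul B).sub h1
  have hv0 := hpos v₀ hv₀
  rcases le_total v₀ v with h | h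
  · have hmono : MonotoneOn (fun u => B * R u - R (a + u)) (Set.Icc v₀ v) := by
      refine monotoneOn_of_deriv_nonneg (convex_Icc _ _) (fun u hu =>
        (hf u (hv₀.trans_le hu.1)).continuousAt.continuousWithinAt) (fun u hu => ?_) fun u hu => ?_
      · rw [interior_Icc] at hu
        exact (hf u (hv₀.trans hu.1)).differentiableAt.differentiableWithinAt
      · rw [interior_Icc] at hu
        rw [(hf u (hv₀.trans hu.1)).deriv]
        have := mul_deriv_shift_le hpos hconc hv₀ hu.1.le ha
        have h2 : R' (a + u) ≤ B * R' u := by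
          rw [hB, div_mul_eq_mul_div, le_div_iff₀ hv0]
          exact this
        linarith
    have := hmono (Set.left_mem_Icc.2 h) (Set.right_mem_Icc.2 h) h
    simp only at this
    linarith
  · have hanti : AntitoneOn (fun u => B * R u - R (a + u)) (Set.Icc v v₀) := by
      refine antitoneOn_of_deriv_nonpos (convex_Icc _ _) (fun u hu =>
        (hf u (hv.trans_le hu.1)).continuousAt.continuousWithinAt) (fun u hu => ?_) fun u hu => ?_
      · rw [interior_Icc] at hu
        exact (hf u (hv.trans hu.1)).differentiableAt.differentiableWithinAt
      · rw [interior_Icc] at hu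
        rw [(hf u (hv.trans hu.1)).deriv]
        have := mul_deriv_shift_le hpos hconc (hv.trans hu.1) hu.2.le ha
        have h2 : B * R' u ≤ R' (a + u) := by
          rw [hB, div_mul_eq_mul_div, div_le_iff₀ hv0]
          exact this
        linarith
    have := hanti (Set.left_mem_Icc.2 h) (Set.right_mem_Icc.2 h) h
    simp only at this
    linarith

lemma exists_add_le_of_logConcave_deriv
    (hder : ∀ t ∈ Set.Ioi (0 : ℝ), HasDerivAt R (R' t) t)
    (hpos : ∀ t ∈ Set.Ioi (0 : ℝ), 0 < R' t)
    (hconc : ConcaveOn ℝ (Set.Ioi 0) fun t => Real.log (R' t))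
    (hRpos : ∀ t : ℝ, 0 < t → 0 < R t)
    (hconv : ConvexOn ℝ (Set.Ioi 0) R) (hrate : SubgeometricRate fun k : ℕ => R k) {ε : ℝ}
    (hε : 0 < ε) :
    ∃ c : ℝ, 0 ≤ c ∧ ∀ t : ℕ, 1 ≤ t → ∀ j : ℕ,
      R (t + j) ≤ R t + (ε * R t + c) * R j := by
  have hR1 := hRpos 1 one_pos
  have hd1 := hpos 1 (Set.mem_Ioi.2 one_pos)
  obtain ⟨c₁, hc₁, hgrow⟩ := SubgeometricRate.exists_succ_sub_le hrate one_pos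
  set L := 2 + c₁ / R 1 with hL
  have hLpos : 0 < L := by positivity
  have hinc : ∀ j : ℕ, R (1 + j) - R 1 ≤ L * R j := by
    intro j
    rcases Nat.eq_zero_or_pos j with rfl | hj
    · have h0 : 0 ≤ R ((0 : ℕ) : ℝ) := hrate.1 0
      have : 0 ≤ L * R ((0 : ℕ) : ℝ) := by positivity
      simpa using this
    · have h1 := hgrow j
      have h2 : R 1 ≤ R j := by simpa using hrate.2.1 hj
      have h3 : c₁ ≤ c₁ / R 1 * R j :=
        calc c₁ = c₁ / R 1 * R 1 := (div_mul_cancel₀ _ hR1.ne').symm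
          _ ≤ _ := by gcongr
      push_cast at h1
      rw [add_comm (1 : ℝ), hL]
      linarith
  obtain ⟨c, hc, hgrow'⟩ := SubgeometricRate.exists_succ_sub_le hrate
    (ε := ε * R' 1 / L) (by positivity)
  refine ⟨c * L / R' 1, by positivity, fun t ht j => ?_⟩
  have ht1 : (1 : ℝ) ≤ t := by exact_mod_cast ht
  have htpos : (0 : ℝ) < t := by linarith
  have hRj : 0 ≤ R j := hrate.1 j
  have hRt := hRpos t htpos
  have htan := shift_sub_le_of_logConcave_deriv hder hpos hconc (a := t - 1) (v₀ := 1)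
    (v := 1 + j) (by linarith) one_pos (by positivity)
  rw [show (t : ℝ) - 1 + (1 + j) = t + j by ring, show (t : ℝ) - 1 + 1 = t by ring] at htan
  have hslope : R' t ≤ ε * R' 1 / L * R t + c := by
    have h1 := hconv.le_slope_of_hasDerivAt (x := (t : ℝ)) (y := t + 1) htpos
      (Set.mem_Ioi.2 (by linarith)) (by linarith) (hder t htpos)
    rw [slope_def_field] at h1
    have h2 := hgrow' t
    push_cast at h2
    rw [add_sub_cancel_left, div_one] at h1
    linarith
  have hfac : 0 ≤ R' t / R' 1 := (div_pos (hpos t htpos) hd1).le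
  have h1 : R' t / R' 1 * (R (1 + j) - R 1) ≤ (ε * R' 1 / L * R t + c) / R' 1 * (L * R j) := by
    calc _ ≤ R' t / R' 1 * (L * R j) := mul_le_mul_of_nonneg_left (hinc j) hfac
      _ ≤ _ := by gcongr
  have h2 : (ε * R' 1 / L * R t + c) / R' 1 * (L * R j) = (ε * R t + c * L / R' 1) * R j := by
    field_simp
  linarith

/-- Jensen's inequality for the concave function `w ↦ R (a + R⁻¹ w)`. -/
lemma lintegral_shift_inverse_le
    (hder : ∀ t ∈ Set.Ioi (0 : ℝ), HasDerivAt R (R' t) t)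
    (hpos : ∀ t ∈ Set.Ioi (0 : ℝ), 0 < R' t)
    (hconc : ConcaveOn ℝ (Set.Ioi 0) fun t => Real.log (R' t))
    (hRpos : ∀ t : ℝ, 0 < t → 0 < R t) {H : ℝ → ℝ}
    (hH : ∀ w : ℝ, 0 < w → 0 < H w ∧ R (H w) = w) {μ : Measure X} [IsProbabilityMeasure μ]
    {W : X → ℝ} (hW : Measurable W) (hW1 : ∀ x, 1 ≤ W x) {w₀ : ℝ} (hw₀ : 0 < w₀)
    (hint : ∫⁻ y, ENNReal.ofReal (W y) ∂μ ≤ ENNReal.ofReal w₀) {a : ℝ} (ha : 0 ≤ a) :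
    ∫⁻ y, ENNReal.ofReal (R (a + H (W y))) ∂μ ≤ ENNReal.ofReal (R (a + H w₀)) := by
  obtain ⟨hv₀, hRv₀⟩ := hH w₀ hw₀
  have ha0 : 0 < a + H w₀ := by linarith
  set B := R' (a + H w₀) / R' (H w₀) with hB
  have hBnn : 0 ≤ B := (div_pos (hpos _ ha0) (hpos _ hv₀)).le
  refine (ENNReal.add_le_add_iff_right (a := ENNReal.ofReal (B * w₀)) ENNReal.ofReal_ne_top).1 ?_
  calc ∫⁻ y, ENNReal.ofReal (R (a + H (W y))) ∂μ + ENNReal.ofReal (B * w₀)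
      = ∫⁻ y, (ENNReal.ofReal (R (a + H (W y))) + ENNReal.ofReal (B * w₀)) ∂μ := by
        rw [lintegral_add_right _ measurable_const]; simp
    _ ≤ ∫⁻ y, (ENNReal.ofReal (R (a + H w₀))
          + ENNReal.ofReal B * ENNReal.ofReal (W y)) ∂μ := lintegral_mono fun y => by
        have hWy : 0 < W y := zero_lt_one.trans_le (hW1 y)
        obtain ⟨hv, hRv⟩ := hH (W y) hWy
        have htan := shift_sub_le_of_logConcave_deriv hder hpos hconc ha hv₀ hv
        rw [hRv, hRv₀, ← hB] at htan
        have h1 : 0 ≤ R (a + H (W y)) := (hRpos _ (by linarith)).le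
        have h2 : 0 ≤ R (a + H w₀) := (hRpos _ ha0).le
        rw [← ENNReal.ofReal_mul hBnn, ← ENNReal.ofReal_add h1 (by positivity),
          ← ENNReal.ofReal_add h2 (by positivity)]
        exact ENNReal.ofReal_le_ofReal (by linarith)
    _ = ENNReal.ofReal (R (a + H w₀))
          + ENNReal.ofReal B * ∫⁻ y, ENNReal.ofReal (W y) ∂μ := by
        rw [lintegral_add_left measurable_const, lintegral_const_mul _ hW.ennreal_ofReal]; simp
    _ ≤ ENNReal.ofReal (R (a + H w₀)) + ENNReal.ofReal B * ENNReal.ofReal w₀ := by gcongr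
    _ = _ := by rw [ENNReal.ofReal_mul hBnn]

end LogConcave

/-- Transfer of an almost-subadditivity bound to extended nonnegative reals. -/
lemma ofReal_rate_add_le {r : ℕ → ℝ} (h0 : ∀ k, 0 ≤ r k)
    (h : ∀ ε : ℝ, 0 < ε → ∃ c : ℝ, 0 ≤ c ∧ ∀ t : ℕ, 1 ≤ t → ∀ j : ℕ,
      r (t + j) ≤ r t + (ε * r t + c) * r j) (ε : NNReal) (hε : 0 < ε) :
    ∃ c : NNReal, ∀ t, 1 ≤ t → ∀ j, ENNReal.ofReal (r (t + j))
      ≤ ENNReal.ofReal (r t) + (ε * ENNReal.ofReal (r t) + c) * ENNReal.ofReal (r j) := by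
  obtain ⟨c, hc, hadd⟩ := h ε (by exact_mod_cast hε)
  refine ⟨c.toNNReal, fun t ht j => (ENNReal.ofReal_le_ofReal (hadd t ht j)).trans_eq ?_⟩
  have h1 := h0 t
  have h2 := h0 j
  rw [ENNReal.ofReal_add h1 (by positivity), ENNReal.ofReal_mul (by positivity),
    ENNReal.ofReal_add (by positivity) hc, ENNReal.ofReal_mul (by positivity),
    ENNReal.ofReal_coe_nnreal]
  rfl

end Rates

end StateDependentDrift

open StateDependentDrift

/-- Corollary `Pi-integ`(i).  Under the state-dependent drift condition of
Theorem `subsampled2moments` with `C` small, `sup_C W < ∞`, `P` phi-irreducible and aperiodic,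
and `R` a subgeometric rate satisfying either case (i) or case (ii), for every accessible set
`D` there is `C' < ∞` with `𝔼ₓ[R(τ_D)] ≤ C' W(x)`. -/
theorem statement10
    (P : Kernel X X) [IsMarkovKernel P]
    (hirr : KIrreducible P) (hap : KAperiodic P)
    (W : X → ℝ) (hWmeas : Measurable W) (hW1 : ∀ x, 1 ≤ W x)
    (n : X → ℕ) (hnmeas : Measurable n) (hn1 : ∀ x, 1 ≤ n x)
    (β : ℝ) (hβ : β ∈ Set.Ioo (0 : ℝ) 1) (b : ℝ) (hb : 0 ≤ b)
    (C : Set X) (hCmeas : MeasurableSet C) (hCsmall : IsSmallSet P C)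
    (hWC : ∃ M : ℝ, ∀ x ∈ C, W x ≤ M)
    (hdrift : ∀ x, kernelExp ((kernelIter P (n x)) x) W
        ≤ ENNReal.ofReal (β * W x + b * Set.indicator C (fun _ => 1) x))
    (R : ℝ → ℝ) (hRmono : StrictMonoOn R (Set.Ioi 0))
    (hRpos : ∀ t : ℝ, 0 < t → 0 < R t)
    (hRrate : SubgeometricRate (fun k : ℕ => R k))
    (hRcase :
      ((∀ s t : ℝ, 0 < s → s ≤ t → R t / t ≤ R s / s) ∧ ∀ x, R (n x) ≤ W x) ∨
      (ConvexOn ℝ (Set.Ioi 0) R ∧ Set.BijOn R (Set.Ioi 0) (Set.Ioi 0) ∧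
        (∃ R' : ℝ → ℝ, ContinuousOn R' (Set.Ioi 0) ∧
          (∀ t ∈ Set.Ioi (0 : ℝ), HasDerivAt R (R' t) t) ∧
          (∀ t ∈ Set.Ioi (0 : ℝ), 0 < R' t) ∧
          ConcaveOn ℝ (Set.Ioi 0) (fun t => Real.log (R' t))) ∧
        (∃ Rinv : ℝ → ℝ,
          (∀ t ∈ Set.Ioi (0 : ℝ), Rinv (R t) = t ∧ R (Rinv t) = t) ∧
          ∀ x, (n x : ℝ) ≤ Rinv (W x) - Rinv (β * W x)))) :
    ∀ D : Set X, MeasurableSet D → Accessible P D →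
      ∃ C' : ℝ, 0 ≤ C' ∧ ∀ x,
        expReturn P D (fun k : ℕ => ENNReal.ofReal (R k)) x ≤ ENNReal.ofReal (C' * W x) := by
  intro D hD hacc
  obtain ⟨hβ0, hβ1⟩ := hβ
  obtain ⟨M, hM⟩ := hWC
  have hmono : Monotone fun k : ℕ => ENNReal.ofReal (R k) := fun i j hij =>
    ENNReal.ofReal_le_ofReal (hRrate.2.1 hij)
  have hR1 : ENNReal.ofReal (R (1 : ℕ)) ≠ 0 := by simpa using hRpos 1 one_pos
  have hWpos : ∀ x, 0 < W x := fun x => zero_lt_one.trans_le (hW1 x)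
  have hRnn : ∀ k : ℕ, 0 ≤ R k := hRrate.1
  have hdrift_off : ∀ x ∉ C, ∫⁻ y, ENNReal.ofReal (W y) ∂(kernelIter P (n x) x)
      ≤ ENNReal.ofReal (β * W x) := fun x hx => by
    simpa [kernelExp, hx] using hdrift x
  have hdrift_all : ∀ x, ∫⁻ y, ENNReal.ofReal (W y) ∂(kernelIter P (n x) x)
      ≤ ENNReal.ofReal (β * W x + b) := fun x => by
    refine (hdrift x).trans (ENNReal.ofReal_le_ofReal ?_)
    by_cases hx : x ∈ C <;> simp [hx, hb]
  rcases hRcase with ⟨hanti, hnW⟩ | ⟨hconv, hbij, ⟨R', -, hder, hpos, hconc⟩, H, hH, hnH⟩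
  · have hβ' : 0 < 1 - β := by linarith
    have hV : ∀ (t : ℕ) (μ : Measure X) [IsProbabilityMeasure μ] (w : ℝ), 0 ≤ w →
        ∫⁻ y, ENNReal.ofReal (W y) ∂μ ≤ ENNReal.ofReal w →
        ∫⁻ y, ENNReal.ofReal (R t + W y / (1 - β)) ∂μ ≤ ENNReal.ofReal (R t + w / (1 - β)) := by
      intro t μ _ w hw hint
      have hfac : 0 ≤ (1 - β)⁻¹ := by positivity
      calc _ = ∫⁻ y, (ENNReal.ofReal (R t)
              + ENNReal.ofReal (1 - β)⁻¹ * ENNReal.ofReal (W y)) ∂μ :=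
            lintegral_congr fun y => by
              have := hWpos y
              rw [ENNReal.ofReal_add (hRnn t) (by positivity), div_eq_inv_mul,
                ENNReal.ofReal_mul hfac]
        _ = ENNReal.ofReal (R t) + ENNReal.ofReal (1 - β)⁻¹ * ∫⁻ y, ENNReal.ofReal (W y) ∂μ := by
            rw [lintegral_add_left measurable_const, lintegral_const_mul _ hWmeas.ennreal_ofReal]
            simp
        _ ≤ ENNReal.ofReal (R t) + ENNReal.ofReal (1 - β)⁻¹ * ENNReal.ofReal w := by gcongr
        _ = _ := by
            rw [← ENNReal.ofReal_mul hfac, ← div_eq_inv_mul,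
              ← ENNReal.ofReal_add (hRnn t) (by positivity)]
    have hsub : ∀ t : ℕ, 1 ≤ t → ∀ j : ℕ, R ((t + j : ℕ) : ℝ) ≤ R t + R j := by
      intro t ht j
      rcases Nat.eq_zero_or_pos j with rfl | hj
      · simpa using hRnn 0
      · push_cast
        exact le_add_of_antitone_div hanti (by exact_mod_cast ht) (by exact_mod_cast hj)
    refine exists_expReturn_le hCmeas hD hCsmall hacc hmono (fun _ => ENNReal.ofReal_ne_top) hR1
      (ofReal_rate_add_le hRnn fun ε hε => ⟨1, zero_le_one, fun t ht j => ?_⟩) hn1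
      (V := fun t y => ENNReal.ofReal (R t + W y / (1 - β))) (fun t _ x => ?_)
      (fun t ht x hx => ?_) hW1 hM (c₀ := 1 + (1 + b) / (1 - β)) (by positivity) fun x => ?_
    · have := mul_nonneg (mul_nonneg hε.le (hRnn t)) (hRnn j)
      linarith [hsub t ht j]
    · have := hWpos x
      exact ENNReal.ofReal_le_ofReal (le_add_of_nonneg_right (by positivity))
    · have := hWpos x
      refine (hV _ _ (β * W x) (by positivity) (hdrift_off x hx)).trans
        (ENNReal.ofReal_le_ofReal ?_)
      have h1 : W x / (1 - β) = W x + β * W x / (1 - β) := by field_simp; ring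
      linarith [hsub t ht (n x), hnW x]
    · have hx := hWpos x
      refine (hV _ _ (β * W x + b) (by positivity) (hdrift_all x)).trans
        (ENNReal.ofReal_le_ofReal ?_)
      have h1 : (β * W x + b) / (1 - β) ≤ (1 + b) * W x / (1 - β) := by
        gcongr
        nlinarith [hW1 x]
      have h2 : (1 + (1 + b) / (1 - β)) * W x = W x + (1 + b) * W x / (1 - β) := by ring
      linarith [hnW x]
  · have hHinv : ∀ w : ℝ, 0 < w → 0 < H w ∧ R (H w) = w := by
      intro w hw
      refine ⟨?_, (hH w hw).2⟩
      obtain ⟨t, ht, rfl⟩ := hbij.surjOn hw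
      rw [(hH t ht).1]
      exact ht
    have hHmono : ∀ v w : ℝ, 0 < v → v ≤ w → H v ≤ H w := by
      intro v w hv hvw
      have hw := hv.trans_le hvw
      refine (hRmono.le_iff_le (hHinv v hv).1 (hHinv w hw).1).1 ?_
      rwa [(hHinv v hv).2, (hHinv w hw).2]
    have hRle : ∀ s t : ℝ, 0 < s → s ≤ t → R s ≤ R t := fun s t hs hst =>
      (hRmono.le_iff_le hs (hs.trans_le hst)).2 hst
    have hV := fun (t : ℕ) (x : X) (w : ℝ) (hw : 0 < w) hint =>
      lintegral_shift_inverse_le hder hpos hconc hRpos hHinv (μ := kernelIter P (n x) x) hWmeas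
        hW1 (w₀ := w) hw hint (a := t) (Nat.cast_nonneg t)
    set M' := max M 1 with hM'
    have hM1 : 1 ≤ M' := le_max_right _ _
    have hMpos : 0 < M' := zero_lt_one.trans_le hM1
    have hbound : 0 < H M' + H (M' + b) :=
      add_pos (hHinv _ hMpos).1 (hHinv _ (by positivity)).1
    have hcnn : 0 ≤ R (H M' + H (M' + b)) := (hRpos _ hbound).le
    have hsmul : ∀ x, 0 < β * W x := fun x => mul_pos hβ0 (hWpos x)
    refine exists_expReturn_le hCmeas hD hCsmall hacc hmono (fun _ => ENNReal.ofReal_ne_top) hR1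
      (ofReal_rate_add_le hRnn fun ε hε => ?_) hn1
      (V := fun t y => ENNReal.ofReal (R (t + H (W y)))) (fun t ht x => ?_)
      (fun t ht x hx => ?_) hW1 hM (c₀ := 1 + R (H M' + H (M' + b))) (by positivity) fun x => ?_
    · push_cast
      exact exists_add_le_of_logConcave_deriv hder hpos hconc hRpos hconv hRrate hε
    · refine ENNReal.ofReal_le_ofReal (hRle _ _ (by exact_mod_cast ht) ?_)
      exact le_add_of_nonneg_right (hHinv _ (hWpos x)).1.le
    · refine (hV _ x _ (hsmul x) (hdrift_off x hx)).trans (ENNReal.ofReal_le_ofReal ?_)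
      have h1 := (hHinv _ (hsmul x)).1
      refine hRle _ _ (by positivity) ?_
      push_cast
      linarith [hnH x]
    · have hHβ := (hHinv _ (hsmul x)).1
      by_cases hx : x ∈ C
      · have hWM : W x ≤ M' := (hM x hx).trans (le_max_left _ _)
        have hw : 0 < β * W x + b := add_pos_of_pos_of_nonneg (hsmul x) hb
        refine (hV _ x _ hw (hdrift_all x)).trans (ENNReal.ofReal_le_ofReal ?_)
        have h1 := (hHinv _ hw).1
        calc R (n x + H (β * W x + b)) ≤ R (H M' + H (M' + b)) := by
              refine hRle _ _ (by positivity) ?_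
              have h2 := hHmono _ _ (hWpos x) hWM
              have h3 := hHmono _ (M' + b) hw (by nlinarith [hWpos x])
              linarith [hnH x]
          _ ≤ (1 + R (H M' + H (M' + b))) * W x := by nlinarith [hW1 x]
      · refine (hV _ x _ (hsmul x) (hdrift_off x hx)).trans (ENNReal.ofReal_le_ofReal ?_)
        calc R (n x + H (β * W x)) ≤ R (H (W x)) := by
              refine hRle _ _ (by positivity) ?_
              linarith [hnH x]
          _ = W x := (hHinv _ (hWpos x)).2
          _ ≤ _ := by nlinarith [hWpos x]
end
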